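/- arXiv:math/9201294 — 3 statements merged into one kernel-verified Lean document; each statement's English description precedes it below -/
import Mathlib

section
/- Let f = h ∘ Q_t (for some t > 1) be a Feigenbaum map in the class U, and for each integer n ≥ 0 write the n-th renormalization R^n(f) of f as f_n = h_n ∘ Q_t with h_n a C^3 diffeomorphism with nonpositive Schwarzian derivative. Then there is a constant C_4 = C_4(f) > 0 such that |(N(h_n))(x)| ≤ C_4 for all x in [-1,0] and all n ≥ 0. -/
open Set MeasureTheory

/-- `Q_t(x) = -|x|^t`. -/
noncomputable def Qmap (t : ℝ) (x : ℝ) : ℝ := -(|x| ^ t)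

/-- Nonlinearity `N(h) = h'' / (h')^2`. -/
noncomputable def Nonlin (h : ℝ → ℝ) (x : ℝ) : ℝ :=
  deriv (deriv h) x / (deriv h x) ^ 2

/-- Schwarzian derivative `S(h) = h'''/h' - (3/2)(h''/h')^2`. -/
noncomputable def Schw (h : ℝ → ℝ) (x : ℝ) : ℝ :=
  deriv (deriv (deriv h)) x / deriv h x - 3 / 2 * (deriv (deriv h) x / deriv h x) ^ 2

/-- A unimodal map of `[-1,1]`: continuous, increasing on `[-1,0]`, decreasing
on `[0,1]`, even, fixing `-1` and sending `1` to `-1`. -/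
def Unimodal (f : ℝ → ℝ) : Prop :=
  ContinuousOn f (Icc (-1) 1) ∧
  StrictMonoOn f (Icc (-1) 0) ∧
  StrictAntiOn f (Icc 0 1) ∧
  (∀ x ∈ Icc (-1 : ℝ) 1, f (-x) = f x) ∧
  f (-1) = -1 ∧ f 1 = -1 ∧
  MapsTo f (Icc (-1) 1) (Icc (-1) 1)

/-- `h` is a `C³` diffeomorphism of `[-1,0]` onto its image (increasing, with
nonvanishing derivative) with nonpositive Schwarzian derivative. -/
def NegSchwDiffeo (h : ℝ → ℝ) : Prop :=
  ContDiffOn ℝ 3 h (Icc (-1) 0) ∧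
  (∀ x ∈ Icc (-1 : ℝ) 0, 0 < deriv h x) ∧
  (∀ x ∈ Icc (-1 : ℝ) 0, Schw h x ≤ 0)

/-- The class `𝒰` of unimodal maps of the form `h ∘ Q_t`, `t > 1`, `h` a `C³`
diffeomorphism with nonpositive Schwarzian derivative. -/
def InU (f : ℝ → ℝ) : Prop :=
  Unimodal f ∧
  ∃ t : ℝ, 1 < t ∧ ∃ h : ℝ → ℝ, NegSchwDiffeo h ∧
    ∀ x ∈ Icc (-1 : ℝ) 1, f x = h (Qmap t x)

/-- The period-doubling renormalization `α ∘ f² ∘ α⁻¹`, where `α` is the linear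
map sending the fixed endpoint `q` of the restrictive interval to `-1`,
i.e. `α (x) = -x/q`. -/
noncomputable def Renorm2 (f : ℝ → ℝ) (q : ℝ) : ℝ → ℝ :=
  fun x => -(f^[2] (-q * x)) / q

/-- `fs` is the sequence of successive period-doubling renormalizations of
`f = fs 0`: for each `k`, `fs k` is unimodal and renormalizable with return
time `2` via the symmetric interval `[-(|qs k|), |qs k|]`, whose endpoint
`qs k` is fixed by `(fs k)²`, and `fs (k+1)` is the rescaled return map. -/
def FeigSeq (f : ℝ → ℝ) (fs : ℕ → ℝ → ℝ) (qs : ℕ → ℝ) : Prop :=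
  fs 0 = f ∧ ∀ k : ℕ,
    Unimodal (fs k) ∧
    0 < |qs k| ∧ |qs k| < 1 ∧
    (fs k)^[2] (qs k) = qs k ∧
    MapsTo ((fs k)^[2]) (Icc (-(|qs k|)) (|qs k|)) (Icc (-(|qs k|)) (|qs k|)) ∧
    fs (k + 1) = Renorm2 (fs k) (qs k)

/-- A Feigenbaum map: every renormalization is defined and renormalizable with
return time `2`. -/
def Feigenbaum (f : ℝ → ℝ) : Prop := ∃ fs qs, FeigSeq f fs qs

/-- The periodic points `p 0 = -1`, `p 1 ∈ (0,1)` the fixed point of `f`, and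
for `n ≥ 2`, `p n` the fixed point of `f^(2^(n-1))` lying strictly between
`-p (n-1)` and `0` or between `0` and `-p (n-1)`.  The interval `I n` is the
closed interval bounded by `p n` and `-p n`, of length `2 * |p n|`. -/
def FeigPoints (f : ℝ → ℝ) (p : ℕ → ℝ) : Prop :=
  p 0 = -1 ∧ p 1 ∈ Ioo (0 : ℝ) 1 ∧ f (p 1) = p 1 ∧
  ∀ n : ℕ, 2 ≤ n →
    f^[2 ^ (n - 1)] (p n) = p n ∧ 0 < |p n| ∧ |p n| < |p (n - 1)|

/-- The intervals of the partition `η₀`: for an index `i = (s, n)` in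
`ℤ ∪ {-0}` (encoded as `Bool × ℕ`, with `|i| = i.2`), `Jint p (true, n)` is the
right component `J n` of `I n \ I (n+1)` and `Jint p (false, n)` is the left
component `J (-n)`. -/
noncomputable def Jint (p : ℕ → ℝ) (i : Bool × ℕ) : Set ℝ :=
  if i.1 = true then Ioc (|p (i.2 + 1)|) (|p i.2|)
  else Ico (-(|p i.2|)) (-(|p (i.2 + 1)|))

/-- A finite sequence of indices is admissible if consecutively the range of
each inverse branch is contained in the domain of the previous one, i.e.
`J (i_l) ⊆ F (J (i_(l-1))) = f^(2^(|i_(l-1)|)) (J (i_(l-1)))`. -/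
def Admissible (f : ℝ → ℝ) (p : ℕ → ℝ) : List (Bool × ℕ) → Prop
  | [] => True
  | [_] => True
  | i :: j :: w => Jint p j ⊆ f^[2 ^ i.2] '' Jint p i ∧ Admissible f p (j :: w)

/-- `gbr i` is the inverse branch `(F|J i)⁻¹` of the induced Markov map `F`,
where `F = f^(2^(|i|))` on `J i`. -/
def InvBranches (f : ℝ → ℝ) (p : ℕ → ℝ) (gbr : Bool × ℕ → ℝ → ℝ) : Prop :=
  ∀ i : Bool × ℕ,
    (∀ x ∈ Jint p i, gbr i (f^[2 ^ i.2] x) = x) ∧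
    MapsTo (gbr i) (f^[2 ^ i.2] '' Jint p i) (Jint p i)

/-- The composed inverse branch `g_w = g_(i₀) ∘ g_(i₁) ∘ ⋯ ∘ g_(i_(k-1))`. -/
def gComp (gbr : Bool × ℕ → ℝ → ℝ) : List (Bool × ℕ) → ℝ → ℝ
  | [] => id
  | i :: w => gbr i ∘ gComp gbr w

/-- The domain `D(g_w)` of the composed inverse branch: the domain
`F (J (i_(k-1)))` of the last branch. -/
noncomputable def DomG (f : ℝ → ℝ) (p : ℕ → ℝ) (w : List (Bool × ℕ)) : Set ℝ :=
  match w.getLast? with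
  | none => ∅
  | some i => f^[2 ^ i.2] '' Jint p i

/-- The length of a set of reals. -/
noncomputable def len (S : Set ℝ) : ℝ := (volume S).toReal

/-- The induced Markov map has the bounded distortion property. -/
def BoundedDistortion (f : ℝ → ℝ) (p : ℕ → ℝ) (gbr : Bool × ℕ → ℝ → ℝ) : Prop :=
  ∃ C > 0,
    (∀ n : ℕ, ∀ s : Bool,
      C ≤ len (Jint p (s, n)) / ∑' l : ℕ, len (Jint p (s, n + 1 + l))) ∧
    (∀ w : List (Bool × ℕ), w ≠ [] → Admissible f p w →
      ∀ x ∈ DomG f p w, |Nonlin (gComp gbr w) x| ≤ C / len (DomG f p w))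

/-- `H` is quasisymmetric on `[-1,1]`. -/
def QuasiSymmetric (H : ℝ → ℝ) : Prop :=
  ∃ M > 0, ∀ x ∈ Icc (-1 : ℝ) 1, ∀ y ∈ Icc (-1 : ℝ) 1, x ≠ y →
    M⁻¹ ≤ |H x - H ((x + y) / 2)| / |H ((x + y) / 2) - H y| ∧
    |H x - H ((x + y) / 2)| / |H ((x + y) / 2) - H y| ≤ M

/-- `H` is a homeomorphism of `[-1,1]` onto itself. -/
def IntervalHomeo (H : ℝ → ℝ) : Prop :=
  ContinuousOn H (Icc (-1) 1) ∧ BijOn H (Icc (-1) 1) (Icc (-1) 1)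

lemma Icc_neg_one_zero_mem_nhds {x : ℝ} (hx : x ∈ Ioo (-1 : ℝ) 0) : Icc (-1 : ℝ) 0 ∈ nhds x :=
  Icc_mem_nhds hx.1 hx.2

namespace NegSchwDiffeo

variable {h : ℝ → ℝ}

lemma differentiableAt (hh : NegSchwDiffeo h) {x : ℝ} (hx : x ∈ Icc (-1 : ℝ) 0) :
    DifferentiableAt ℝ h x :=
  differentiableAt_of_deriv_ne_zero (hh.2.1 x hx).ne'

lemma contDiffAt (hh : NegSchwDiffeo h) {x : ℝ} (hx : x ∈ Ioo (-1 : ℝ) 0) :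
    ContDiffAt ℝ 3 h x :=
  hh.1.contDiffAt (Icc_neg_one_zero_mem_nhds hx)

lemma contDiffAt_deriv (hh : NegSchwDiffeo h) {x : ℝ} (hx : x ∈ Ioo (-1 : ℝ) 0) :
    ContDiffAt ℝ 2 (deriv h) x :=
  (hh.contDiffAt hx).derivWithin (by norm_num)

lemma contDiffAt_deriv_deriv (hh : NegSchwDiffeo h) {x : ℝ} (hx : x ∈ Ioo (-1 : ℝ) 0) :
    ContDiffAt ℝ 1 (deriv (deriv h)) x :=
  (hh.contDiffAt_deriv hx).derivWithin (by norm_num)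

lemma strictMonoOn (hh : NegSchwDiffeo h) : StrictMonoOn h (Icc (-1) 0) :=
  strictMonoOn_of_deriv_pos (convex_Icc _ _) hh.1.continuousOn
    fun x hx => hh.2.1 x (interior_subset hx)

lemma derivWithin_eq (hh : NegSchwDiffeo h) {x : ℝ} (hx : x ∈ Icc (-1 : ℝ) 0) :
    derivWithin h (Icc (-1) 0) x = deriv h x :=
  (hh.differentiableAt hx).derivWithin (uniqueDiffOn_Icc (by norm_num) x hx)

lemma exists_continuousOn_nonlin (hh : NegSchwDiffeo h) :
    ∃ G : ℝ → ℝ, ContinuousOn G (Icc (-1) 0) ∧ (∀ x ∈ Ioo (-1 : ℝ) 0, Nonlin h x = G x) ∧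
      ∀ x ∈ Icc (-1 : ℝ) 0, |Nonlin h x| ≤ |G x| := by
  have hu : UniqueDiffOn ℝ (Icc (-1 : ℝ) 0) := uniqueDiffOn_Icc (by norm_num)
  set g₁ := derivWithin h (Icc (-1) 0)
  have h₁ : ContDiffOn ℝ 2 g₁ (Icc (-1) 0) := hh.1.derivWithin hu (by norm_num)
  have h₂ : ContDiffOn ℝ 1 (derivWithin g₁ (Icc (-1) 0)) (Icc (-1) 0) :=
    h₁.derivWithin hu (by norm_num)
  have key : ∀ x ∈ Icc (-1 : ℝ) 0, DifferentiableAt ℝ (deriv h) x →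
      deriv (deriv h) x = derivWithin g₁ (Icc (-1) 0) x := by
    intro x hx hd
    rw [← hd.derivWithin (hu x hx)]
    exact derivWithin_congr (fun y hy => (hh.derivWithin_eq hy).symm) (hh.derivWithin_eq hx).symm
  refine ⟨fun x => derivWithin g₁ (Icc (-1) 0) x / g₁ x ^ 2, ?_, ?_, ?_⟩
  · refine h₂.continuousOn.div (h₁.continuousOn.pow 2) fun x hx => ?_
    have : 0 < g₁ x := (hh.2.1 x hx).trans_eq (hh.derivWithin_eq hx).symm
    positivity
  · intro x hx
    have hx' := Ioo_subset_Icc_self hx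
    simp only [Nonlin]
    rw [key x hx' ((hh.contDiffAt_deriv hx).differentiableAt (by norm_num)),
      ← hh.derivWithin_eq hx']
  · intro x hx
    simp only [Nonlin]
    by_cases hd : DifferentiableAt ℝ (deriv h) x
    · rw [key x hx hd, ← hh.derivWithin_eq hx]
    · rw [deriv_zero_of_not_differentiableAt hd]
      simp

lemma exists_abs_nonlin_le (hh : NegSchwDiffeo h) :
    ∃ C, ∀ x ∈ Icc (-1 : ℝ) 0, |Nonlin h x| ≤ C := by
  obtain ⟨G, hG, -, hle⟩ := hh.exists_continuousOn_nonlin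
  obtain ⟨C, hC⟩ := isCompact_Icc.exists_bound_of_continuousOn hG
  exact ⟨C, fun x hx => (hle x hx).trans (hC x hx)⟩

lemma abs_nonlin_le_of_Ioo (hh : NegSchwDiffeo h) {C : ℝ}
    (hC : ∀ x ∈ Ioo (-1 : ℝ) 0, |Nonlin h x| ≤ C) {x : ℝ} (hx : x ∈ Icc (-1 : ℝ) 0) :
    |Nonlin h x| ≤ C := by
  obtain ⟨G, hG, heq, hle⟩ := hh.exists_continuousOn_nonlin
  refine (hle x hx).trans ?_
  have hcl : closure (Ioo (-1 : ℝ) 0) = Icc (-1) 0 := closure_Ioo (by norm_num)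
  have hmaps : MapsTo G (Ioo (-1) 0) {y | |y| ≤ C} := fun y hy => heq y hy ▸ hC y hy
  exact (isClosed_le continuous_abs continuous_const).closure_subset
    (hmaps.closure_of_continuousOn (hcl ▸ hG) (hcl ▸ hx))

lemma exists_biLipschitz (hh : NegSchwDiffeo h) :
    ∃ m M : ℝ, 0 < m ∧ m ≤ M ∧ ∀ u ∈ Icc (-1 : ℝ) 0, ∀ v ∈ Icc (-1 : ℝ) 0, u ≤ v →
      m * (v - u) ≤ h v - h u ∧ h v - h u ≤ M * (v - u) := by
  have hu : UniqueDiffOn ℝ (Icc (-1 : ℝ) 0) := uniqueDiffOn_Icc (by norm_num)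
  have hc : ContinuousOn (deriv h) (Icc (-1 : ℝ) 0) :=
    (hh.1.continuousOn_derivWithin hu (by norm_num)).congr
      fun x hx => (hh.derivWithin_eq hx).symm
  have hne : (Icc (-1 : ℝ) 0).Nonempty := ⟨0, by norm_num⟩
  obtain ⟨a, ha, hmin⟩ := isCompact_Icc.exists_isMinOn hne hc
  obtain ⟨b, hb, hmax⟩ := isCompact_Icc.exists_isMaxOn hne hc
  refine ⟨deriv h a, deriv h b, hh.2.1 a ha, hmax ha, fun u hu' v hv huv => ?_⟩
  have hi : interior (Icc (-1 : ℝ) 0) ⊆ Icc (-1 : ℝ) 0 := interior_subset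
  have hd : DifferentiableOn ℝ h (interior (Icc (-1 : ℝ) 0)) :=
    fun x hx => (hh.differentiableAt (hi hx)).differentiableWithinAt
  exact ⟨(convex_Icc _ _).mul_sub_le_image_sub_of_le_deriv hh.1.continuousOn hd
      (fun x hx => hmin (hi hx)) u hu' v hv huv,
    (convex_Icc _ _).image_sub_le_mul_sub_of_deriv_le hh.1.continuousOn hd
      (fun x hx => hmax (hi hx)) u hu' v hv huv⟩

/-- The two-point form of the condition of nonpositive Schwarzian derivative. -/
lemma deriv_mul_deriv_mul_sq_le (hh : NegSchwDiffeo h) {x y : ℝ} (hx : -1 < x) (hxy : x < y)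
    (hy : y < 0) : deriv h x * deriv h y * (y - x) ^ 2 ≤ (h y - h x) ^ 2 := by
  have hsub : ∀ s ∈ Icc x y, s ∈ Ioo (-1 : ℝ) 0 := fun s hs =>
    ⟨hx.trans_le hs.1, hs.2.trans_lt hy⟩
  have hpos : ∀ s ∈ Icc x y, 0 < deriv h s := fun s hs =>
    hh.2.1 s (Ioo_subset_Icc_self (hsub s hs))
  set v : ℝ → ℝ := fun s => Real.exp (-(Real.log (deriv h s)) / 2) with hv
  have hvsq : ∀ s ∈ Icc x y, v s ^ 2 = (deriv h s)⁻¹ := by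
    intro s hs
    rw [hv, ← Real.exp_nat_mul, ← Real.exp_log (hpos s hs), Real.log_exp, ← Real.exp_neg]
    congr 1
    push_cast
    ring
  have hvd : ∀ s ∈ Icc x y,
      HasDerivAt v (v s * (-(deriv (deriv h) s / deriv h s) / 2)) s := by
    intro s hs
    have h1 := ((hh.contDiffAt_deriv (hsub s hs)).differentiableAt (by norm_num)).hasDerivAt
    exact ((h1.log (hpos s hs).ne').neg.div_const 2).exp
  have hvd2 : ∀ s ∈ Icc x y,
      HasDerivAt (fun s => v s * (-(deriv (deriv h) s / deriv h s) / 2))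
        (v s * (-(Schw h s) / 2)) s := by
    intro s hs
    have h1 := ((hh.contDiffAt_deriv (hsub s hs)).differentiableAt (by norm_num)).hasDerivAt
    have h2 := ((hh.contDiffAt_deriv_deriv (hsub s hs)).differentiableAt
      (by norm_num)).hasDerivAt
    refine ((hvd s hs).mul ((h2.div h1 (hpos s hs).ne').neg.div_const 2)).congr_deriv ?_
    have := (hpos s hs).ne'
    simp only [Schw, Pi.neg_apply, Pi.div_apply]
    field_simp
    ring
  have hconv : ConvexOn ℝ (Icc x y) v := by
    refine MonotoneOn.convexOn_of_deriv (convex_Icc _ _)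
      (fun s hs => (hvd s hs).continuousAt.continuousWithinAt)
      (fun s hs => (hvd s (interior_subset hs)).differentiableAt.differentiableWithinAt) ?_
    refine MonotoneOn.congr (f₁ := fun s => v s * (-(deriv (deriv h) s / deriv h s) / 2)) ?_
      fun s hs => (hvd s (interior_subset hs)).deriv.symm
    refine MonotoneOn.mono ?_ (interior_subset (s := Icc x y))
    refine monotoneOn_of_deriv_nonneg (convex_Icc _ _)
      (fun s hs => (hvd2 s hs).continuousAt.continuousWithinAt)
      (fun s hs => (hvd2 s (interior_subset hs)).differentiableAt.differentiableWithinAt) ?_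
    intro s hs
    rw [(hvd2 s (interior_subset hs)).deriv]
    have := hh.2.2 s (Ioo_subset_Icc_self (hsub s (interior_subset hs)))
    have h3 : 0 < v s := Real.exp_pos _
    exact mul_nonneg h3.le (by linarith)
  have hvx : 0 < v x := Real.exp_pos _
  have hvy : 0 < v y := Real.exp_pos _
  have hyx : 0 < y - x := sub_pos.2 hxy
  set l : ℝ → ℝ := fun s => v x + (v y - v x) / (y - x) * (s - x) with hl
  have hvl : ∀ s ∈ Icc x y, v s ≤ l s := by
    intro s hs
    have hc := hconv.2 (left_mem_Icc.2 hxy.le) (right_mem_Icc.2 hxy.le)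
            (show 0 ≤ (y - s) / (y - x) from div_nonneg (by linarith [hs.2]) hyx.le)
      (show 0 ≤ (s - x) / (y - x) from div_nonneg (by linarith [hs.1]) hyx.le)
      (by field_simp; ring)
    have e1 : ((y - s) / (y - x)) • x + ((s - x) / (y - x)) • y = s := by
      simp only [smul_eq_mul]; field_simp; ring
    have e2 : ((y - s) / (y - x)) • v x + ((s - x) / (y - x)) • v y = l s := by
      simp only [smul_eq_mul, hl]; field_simp; ring
    rwa [e1, e2] at hc
  have hlpos : ∀ s ∈ Icc x y, 0 < l s := fun s hs => (Real.exp_pos _).trans_le (hvl s hs)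
  have hld : ∀ s, HasDerivAt l ((v y - v x) / (y - x)) s := by
    intro s
    exact ((((hasDerivAt_id s).sub_const x).const_mul ((v y - v x) / (y - x))).const_add
      (v x)).congr_deriv (mul_one _)
  have hFd : ∀ s ∈ Icc x y, HasDerivAt (fun s => h s - (s - x) / (v x * l s))
      (deriv h s - 1 / l s ^ 2) s := by
    intro s hs
    have hne := (hlpos s hs).ne'
    refine ((hh.differentiableAt (Ioo_subset_Icc_self (hsub s hs))).hasDerivAt.sub
      (((hasDerivAt_id s).sub_const x).div ((hld s).const_mul (v x))
        (mul_ne_zero hvx.ne' hne))).congr_deriv ?_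
    congr 1
    simp only [id]
    rw [div_eq_div_iff (by positivity) (by positivity)]
    simp only [hl]
    ring
  have hmono : MonotoneOn (fun s => h s - (s - x) / (v x * l s)) (Icc x y) := by
    refine monotoneOn_of_deriv_nonneg (convex_Icc _ _)
      (fun s hs => (hFd s hs).continuousAt.continuousWithinAt)
      (fun s hs => (hFd s (interior_subset hs)).differentiableAt.differentiableWithinAt) ?_
    intro s hs
    have hs' := interior_subset hs
    rw [(hFd s hs').deriv, ← inv_inv (deriv h s), ← hvsq s hs', sub_nonneg, one_div]
    have : 0 < v s := Real.exp_pos _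
    gcongr
    exact hvl s hs'
  have hfin := hmono (left_mem_Icc.2 hxy.le) (right_mem_Icc.2 hxy.le) hxy.le
  have hly : l y = v y := by simp only [hl]; field_simp; ring
  simp only [sub_self, zero_div, sub_zero, hly] at hfin
  have h4 : (y - x) / (v x * v y) ≤ h y - h x := by linarith
  calc deriv h x * deriv h y * (y - x) ^ 2 = ((y - x) / (v x * v y)) ^ 2 := by
        rw [div_pow, mul_pow, hvsq x (left_mem_Icc.2 hxy.le), hvsq y (right_mem_Icc.2 hxy.le)]
        have := hpos x (left_mem_Icc.2 hxy.le)
        have := hpos y (right_mem_Icc.2 hxy.le)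
        field_simp
    _ ≤ _ := by
        gcongr

end NegSchwDiffeo

/-- The cross-ratio of four points on the line. -/
noncomputable def crossRatio (w x y z : ℝ) : ℝ := (z - w) * (y - x) / ((x - w) * (z - y))

lemma crossRatio_reverse (w x y z : ℝ) : crossRatio z y x w = crossRatio w x y z := by
  unfold crossRatio
  congr 1 <;> ring

lemma crossRatio_neg (w x y z : ℝ) :
    crossRatio (-w) (-x) (-y) (-z) = crossRatio w x y z := by
  unfold crossRatio
  congr 1 <;> ring

lemma crossRatio_div (w x y z : ℝ) {p : ℝ} (hp : p ≠ 0) :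
    crossRatio (w / p) (x / p) (y / p) (z / p) = crossRatio w x y z := by
  unfold crossRatio
  rw [← sub_div, ← sub_div, ← sub_div, ← sub_div, div_mul_div_comm, div_mul_div_comm,
    div_div_div_cancel_right₀ (mul_ne_zero hp hp)]

/-- An increasing function satisfying the strict two-point inequality strictly expands
cross-ratios. -/
lemma crossRatio_lt_of_two_point {g g' : ℝ → ℝ} (hc : ContinuousOn g (Icc 0 1))
    (hm : StrictMonoOn g (Icc 0 1)) (hd : ∀ x ∈ Ioo (0 : ℝ) 1, HasDerivAt g (g' x) x)
    (hpos : ∀ x ∈ Ioo (0 : ℝ) 1, 0 < g' x)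
    (hP : ∀ x y : ℝ, 0 < x → x < y → y < 1 → g' x * g' y * (y - x) ^ 2 < (g y - g x) ^ 2)
    {w x y z : ℝ} (hw : 0 ≤ w) (hwx : w < x) (hxy : x < y) (hyz : y < z) (hz : z ≤ 1) :
    crossRatio w x y z < crossRatio (g w) (g x) (g y) (g z) := by
  have hmlt : ∀ a b : ℝ, 0 ≤ a → a < b → b ≤ 1 → 0 < g b - g a := fun a b ha hab hb =>
    sub_pos.2 (hm ⟨ha, hab.le.trans hb⟩ ⟨ha.trans hab.le, hb⟩ hab)
  have step : ∀ s : ℝ, 0 < s → s < y →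
      1 / (g' s * (z - s)) - 1 / (g z - g s) < 1 / (g' s * (y - s)) - 1 / (g y - g s) := by
    intro s hs hsy
    have hs1 : s < 1 := by linarith
    have hgs := hpos s ⟨hs, hs1⟩
    have hanti : StrictAntiOn (fun u => 1 / (g' s * (u - s)) - 1 / (g u - g s)) (Icc y z) := by
      have hsub : ∀ u ∈ Icc y z, 0 < u - s ∧ 0 < g u - g s := fun u hu =>
        ⟨by linarith [hu.1], hmlt s u hs.le (by linarith [hu.1]) (hu.2.trans hz)⟩
      refine strictAntiOn_of_deriv_neg (convex_Icc _ _) ?_ ?_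
      · have hcg : ContinuousOn g (Icc y z) :=
          hc.mono (Icc_subset_Icc (by linarith) hz)
        refine ContinuousOn.sub (continuousOn_const.div (by fun_prop) fun u hu => ?_)
          (continuousOn_const.div (hcg.sub continuousOn_const) fun u hu => (hsub u hu).2.ne')
        exact (mul_pos hgs (hsub u hu).1).ne'
      · intro u hu
        rw [interior_Icc] at hu
        obtain ⟨h1, h2⟩ := hsub u (Ioo_subset_Icc_self hu)
        have hu1 : u < 1 := hu.2.trans_le hz
        have hsu : s < u := hsy.trans hu.1
        have hD : HasDerivAt (fun u => 1 / (g' s * (u - s)) - 1 / (g u - g s))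
            (g' u / (g u - g s) ^ 2 - 1 / (g' s * (u - s) ^ 2)) u := by
          refine (((hasDerivAt_const u (1 : ℝ)).div
            (((hasDerivAt_id u).sub_const s).const_mul (g' s)) (mul_pos hgs h1).ne').sub
            ((hasDerivAt_const u (1 : ℝ)).div ((hd u ⟨hs.trans hsu, hu1⟩).sub_const (g s))
            h2.ne')).congr_deriv ?_
          simp only [id]
          field_simp
          ring
        rw [hD.deriv, sub_neg, div_lt_div_iff₀ (by positivity) (by positivity)]
        have := hP s u hs hsu hu1
        linarith
    exact hanti (left_mem_Icc.2 hyz.le) (right_mem_Icc.2 hyz.le) hyz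
  have hmono : StrictMonoOn (fun s => Real.log (g y - g s) - Real.log (g z - g s) -
      Real.log (y - s) + Real.log (z - s)) (Icc w x) := by
    have hsub : ∀ s ∈ Icc w x, 0 < g y - g s ∧ 0 < g z - g s ∧ 0 < y - s ∧ 0 < z - s := by
      intro s hs
      have h0 : 0 ≤ s := hw.trans hs.1
      have h1 : s < y := hs.2.trans_lt hxy
      exact ⟨hmlt s y h0 h1 (by linarith), hmlt s z h0 (by linarith) hz, by linarith,
        by linarith⟩
    refine strictMonoOn_of_deriv_pos (convex_Icc _ _) ?_ ?_
    · have hcg : ContinuousOn g (Icc w x) := hc.mono (Icc_subset_Icc hw (by linarith))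
      refine ContinuousOn.add (ContinuousOn.sub (ContinuousOn.sub ?_ ?_) ?_) ?_
      · exact (continuousOn_const.sub hcg).log fun s hs => (hsub s hs).1.ne'
      · exact (continuousOn_const.sub hcg).log fun s hs => (hsub s hs).2.1.ne'
      · exact (continuousOn_const.sub continuousOn_id).log fun s hs => (hsub s hs).2.2.1.ne'
      · exact (continuousOn_const.sub continuousOn_id).log fun s hs => (hsub s hs).2.2.2.ne'
    · intro s hs
      rw [interior_Icc] at hs
      obtain ⟨h1, h2, h3, h4⟩ := hsub s (Ioo_subset_Icc_self hs)
      have hs0 : 0 < s := hw.trans_lt hs.1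
      have hs1 : s < 1 := by linarith [hs.2]
      have hgs := hpos s ⟨hs0, hs1⟩
      have hg := hd s ⟨hs0, hs1⟩
      have hD := ((((hg.const_sub (g y)).log h1.ne').sub ((hg.const_sub (g z)).log h2.ne')).sub
        (((hasDerivAt_id s).const_sub y).log h3.ne')).add
        (((hasDerivAt_id s).const_sub z).log h4.ne')
      have hval : 0 < -g' s / (g y - g s) - -g' s / (g z - g s) - -1 / (y - s) + -1 / (z - s) := by
        have hst := mul_lt_mul_of_pos_left (step s hs0 (hs.2.trans hxy)) hgs
        have e1 : g' s * (1 / (g' s * (z - s)) - 1 / (g z - g s)) =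
            1 / (z - s) - g' s / (g z - g s) := by field_simp
        have e2 : g' s * (1 / (g' s * (y - s)) - 1 / (g y - g s)) =
            1 / (y - s) - g' s / (g y - g s) := by field_simp
        rw [e1, e2] at hst
        simp only [neg_div]
        linarith
      exact hval.trans_eq hD.deriv.symm
  have hlog := hmono (left_mem_Icc.2 hwx.le) (right_mem_Icc.2 hwx.le) hwx
  have hyw : 0 < g y - g w := hmlt w y hw (by linarith) (by linarith)
  have hzw : 0 < g z - g w := hmlt w z hw (by linarith) hz
  have hyx : 0 < g y - g x := hmlt x y (by linarith) hxy (by linarith)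
  have hzx : 0 < g z - g x := hmlt x z (by linarith) (by linarith) hz
  have hxw : 0 < g x - g w := hmlt w x hw hwx (by linarith)
  have hzy : 0 < g z - g y := hmlt y z (by linarith) hyz hz
  have a1 : 0 < y - w := by linarith
  have a2 : 0 < z - w := by linarith
  have a3 : 0 < y - x := by linarith
  have a4 : 0 < z - x := by linarith
  have hprod : (g y - g w) * (g z - g x) * ((y - x) * (z - w)) <
      (g y - g x) * (g z - g w) * ((y - w) * (z - x)) := by
    rw [← Real.log_lt_log_iff (by positivity) (by positivity)]
    rw [Real.log_mul (by positivity) (by positivity), Real.log_mul (by positivity) (by positivity),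
      Real.log_mul (by positivity) (by positivity), Real.log_mul (by positivity) (by positivity),
      Real.log_mul (by positivity) (by positivity), Real.log_mul (by positivity) (by positivity)]
    simp only at hlog
    linarith
  unfold crossRatio
  rw [div_lt_div_iff₀ (mul_pos (by linarith) (by linarith)) (mul_pos hxw hzy)]
  linarith

lemma mul_sinh_lt_sinh_mul {t a : ℝ} (ht : 1 < t) (ha : 0 < a) :
    t * Real.sinh a < Real.sinh (t * a) := by
  have hd : ∀ x, HasDerivAt (fun x => Real.sinh (t * x) - t * Real.sinh x)
      (Real.cosh (t * x) * (t * 1) - t * Real.cosh x) x := fun x =>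
    ((((hasDerivAt_id x).const_mul t).sinh).sub ((Real.hasDerivAt_sinh x).const_mul t))
  have hmono : StrictMonoOn (fun x => Real.sinh (t * x) - t * Real.sinh x) (Icc 0 a) := by
    refine strictMonoOn_of_deriv_pos (convex_Icc _ _)
      (fun x _ => (hd x).continuousAt.continuousWithinAt) fun x hx => ?_
    rw [interior_Icc] at hx
    rw [(hd x).deriv]
    have : Real.cosh x < Real.cosh (t * x) := by
      rw [Real.cosh_lt_cosh, abs_of_pos hx.1, abs_of_pos (by have := hx.1; positivity)]
      nlinarith [hx.1]
    nlinarith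
  have := hmono (left_mem_Icc.2 ha.le) (right_mem_Icc.2 ha.le) ha
  simp only [mul_zero, Real.sinh_zero, sub_zero] at this
  linarith

lemma rpow_two_point {t x y : ℝ} (ht : 1 < t) (hx : 0 < x) (hxy : x < y) :
    t * x ^ (t - 1) * (t * y ^ (t - 1)) * (y - x) ^ 2 < (y ^ t - x ^ t) ^ 2 := by
  have hy : 0 < y := hx.trans hxy
  set a := Real.log x
  set b := Real.log y
  have hab : a < b := Real.log_lt_log hx hxy
  have h := mul_sinh_lt_sinh_mul ht (show 0 < (b - a) / 2 by linarith)
  have hxe : x = Real.exp a := (Real.exp_log hx).symm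
  have hye : y = Real.exp b := (Real.exp_log hy).symm
  have key : ∀ s : ℝ, Real.exp (b * s) - Real.exp (a * s) =
      Real.exp ((a + b) / 2 * s) * (2 * Real.sinh (s * ((b - a) / 2))) := by
    intro s
    rw [Real.sinh_eq, mul_div_cancel₀ _ two_ne_zero, mul_sub, ← Real.exp_add, ← Real.exp_add]
    congr 2 <;> ring
  have k1 := key 1
  have kt := key t
  simp only [mul_one, one_mul] at k1
  have hsinh : 0 < Real.sinh ((b - a) / 2) := Real.sinh_pos_iff.2 (by linarith)
  rw [hxe, hye, ← Real.exp_mul, ← Real.exp_mul, ← Real.exp_mul, ← Real.exp_mul, k1, kt]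
  have e : Real.exp (a * (t - 1)) * Real.exp (b * (t - 1)) * Real.exp ((a + b) / 2) ^ 2 =
      Real.exp ((a + b) / 2 * t) ^ 2 := by
    rw [← Real.exp_nat_mul, ← Real.exp_nat_mul, ← Real.exp_add, ← Real.exp_add]
    congr 1
    push_cast
    ring
  calc _ = (Real.exp (a * (t - 1)) * Real.exp (b * (t - 1)) * Real.exp ((a + b) / 2) ^ 2) *
        (4 * (t * Real.sinh ((b - a) / 2)) ^ 2) := by ring
    _ < Real.exp ((a + b) / 2 * t) ^ 2 * (4 * Real.sinh (t * ((b - a) / 2)) ^ 2) := by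
        rw [e]
        have : 0 < t := by linarith
        gcongr
    _ = _ := by ring

lemma qmap_of_nonneg {t y : ℝ} (hy : 0 ≤ y) : Qmap t y = -(y ^ t) := by
  rw [Qmap, abs_of_nonneg hy]

/-- A unimodal map `h ∘ Q_t` in the class `𝒰` strictly expands cross-ratios on `[0,1]`. -/
lemma crossRatio_lt_of_unimodal {f h : ℝ → ℝ} {t : ℝ} (ht : 1 < t) (hf : Unimodal f)
    (hh : NegSchwDiffeo h) (hfh : ∀ x ∈ Icc (-1 : ℝ) 1, f x = h (Qmap t x)) {w x y z : ℝ}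
    (hw : 0 ≤ w) (hwx : w < x) (hxy : x < y) (hyz : y < z) (hz : z ≤ 1) :
    crossRatio w x y z < crossRatio (f w) (f x) (f y) (f z) := by
  have hQ : ∀ u ∈ Ioo (0 : ℝ) 1, -(u ^ t) ∈ Ioo (-1 : ℝ) 0 := fun u hu =>
    ⟨neg_lt_neg (Real.rpow_lt_one hu.1.le hu.2 (by linarith)),
      neg_lt_zero.2 (Real.rpow_pos_of_pos hu.1 t)⟩
  have hg : ∀ u ∈ Ioo (0 : ℝ) 1, HasDerivAt (fun u => -f u)
      (deriv h (-(u ^ t)) * (t * u ^ (t - 1))) u := by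
    intro u hu
    have h1 := (hh.differentiableAt (Ioo_subset_Icc_self (hQ u hu))).hasDerivAt
    have h2 : HasDerivAt (fun u : ℝ => -(u ^ t)) (-(t * u ^ (t - 1))) u :=
      (Real.hasDerivAt_rpow_const (Or.inl hu.1.ne')).neg
    have h3 : HasDerivAt (fun u => -h (-(u ^ t))) (deriv h (-(u ^ t)) * (t * u ^ (t - 1))) u :=
      (h1.comp u h2).neg.congr_deriv (by ring)
    refine h3.congr_of_eventuallyEq ?_
    filter_upwards [Ioo_mem_nhds hu.1 hu.2] with v hv
    rw [hfh v ⟨by linarith [hv.1], hv.2.le⟩, qmap_of_nonneg hv.1.le]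
  have hcr := crossRatio_lt_of_two_point (g := fun u => -f u)
    (hf.1.mono (Icc_subset_Icc (by norm_num) le_rfl)).neg
    (fun a ha b hb hab => neg_lt_neg (hf.2.2.1 ha hb hab)) hg
    (fun u hu => mul_pos (hh.2.1 _ (Ioo_subset_Icc_self (hQ u hu)))
      (mul_pos (by linarith) (Real.rpow_pos_of_pos hu.1 _))) ?_ hw hwx hxy hyz hz
  · simpa only [crossRatio_neg] using hcr
  · intro a b ha hab hb
    have hQa := hQ a ⟨ha, hab.trans hb⟩
    have hQb := hQ b ⟨ha.trans hab, hb⟩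
    have hQab : -(b ^ t) < -(a ^ t) := neg_lt_neg (Real.rpow_lt_rpow ha.le hab (by linarith))
    have h1 := hh.deriv_mul_deriv_mul_sq_le hQb.1 hQab hQa.2
    have h2 := rpow_two_point ht ha hab
    have hpa := hh.2.1 _ (Ioo_subset_Icc_self hQa)
    have hpb := hh.2.1 _ (Ioo_subset_Icc_self hQb)
    rw [hfh a ⟨by linarith, by linarith⟩, hfh b ⟨by linarith, by linarith⟩,
      qmap_of_nonneg ha.le, qmap_of_nonneg (ha.trans hab).le]
    calc _ = deriv h (-(a ^ t)) * deriv h (-(b ^ t)) *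
          (t * a ^ (t - 1) * (t * b ^ (t - 1)) * (b - a) ^ 2) := by ring
      _ < deriv h (-(a ^ t)) * deriv h (-(b ^ t)) * (b ^ t - a ^ t) ^ 2 := by gcongr
      _ = deriv h (-(b ^ t)) * deriv h (-(a ^ t)) * (-(a ^ t) - -(b ^ t)) ^ 2 := by ring
      _ ≤ (h (-(a ^ t)) - h (-(b ^ t))) ^ 2 := h1
      _ = _ := by ring

lemma renorm2_apply (f : ℝ → ℝ) (q x : ℝ) : Renorm2 f q x = -(f (f (-q * x))) / q := rfl

namespace Unimodal

variable {f : ℝ → ℝ} {q : ℝ}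

lemma continuousAt (hf : Unimodal f) {x : ℝ} (hx : x ∈ Ioo (-1 : ℝ) 1) : ContinuousAt f x :=
  hf.1.continuousAt (Icc_mem_nhds hx.1 hx.2)

lemma mapsTo (hf : Unimodal f) {x : ℝ} (hx : x ∈ Icc (-1 : ℝ) 1) : f x ∈ Icc (-1 : ℝ) 1 :=
  hf.2.2.2.2.2.2 hx

lemma lt_of_lt_of_nonpos (hf : Unimodal f) {x y : ℝ} (hx : -1 ≤ x) (hxy : x < y) (hy : y ≤ 0) :
    f x < f y :=
  hf.2.1 ⟨hx, hxy.le.trans hy⟩ ⟨hx.trans hxy.le, hy⟩ hxy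

lemma lt_of_lt_of_nonneg (hf : Unimodal f) {x y : ℝ} (hx : 0 ≤ x) (hxy : x < y) (hy : y ≤ 1) :
    f y < f x :=
  hf.2.2.1 ⟨hx, hxy.le.trans hy⟩ ⟨hx.trans hxy.le, hy⟩ hxy

lemma apply_nonneg_of_renorm (hf : Unimodal f) (hR : Unimodal (Renorm2 f q)) (hq : 0 < q)
    (hq1 : q < 1) : 0 ≤ f q := by
  by_contra! hneg
  have hev : ∀ᶠ y in nhds q, f y < 0 ∧ 0 < y :=
    ((hf.continuousAt ⟨by linarith, hq1⟩).eventually_lt_const hneg).and (lt_mem_nhds hq)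
  obtain ⟨y, ⟨hy, hy0⟩, hyq⟩ :=
    ((hev.filter_mono nhdsWithin_le_nhds).and (self_mem_nhdsWithin (s := Iio q))).exists
  have hyq : y < q := hyq
  have h1 : f q < f y := hf.lt_of_lt_of_nonneg hy0.le hyq hq1.le
  have h2 := hf.lt_of_lt_of_nonpos (hf.mapsTo ⟨by linarith, hq1.le⟩).1 h1 hy.le
  have h3 := hR.lt_of_lt_of_nonpos le_rfl (show -1 < -(y / q) by
    rw [neg_lt_neg_iff, div_lt_one hq]; exact hyq) (neg_nonpos.2 (by positivity))
  rw [renorm2_apply, renorm2_apply, show -q * -1 = q by ring,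
    show -q * -(y / q) = y by field_simp, div_lt_div_iff_of_pos_right hq] at h3
  linarith

lemma apply_zero_nonpos_of_renorm (hf : Unimodal f) (hR : Unimodal (Renorm2 f q)) (hq : q < 0)
    (hq1 : -1 < q) : f 0 ≤ 0 := by
  by_contra! hpos
  have hev : ∀ᶠ y in nhds (0 : ℝ), 0 < f y ∧ q < y :=
    ((hf.continuousAt ⟨by norm_num, by norm_num⟩).eventually_const_lt hpos).and (lt_mem_nhds hq)
  obtain ⟨y, ⟨hy, hyq⟩, hy0⟩ :=
    ((hev.filter_mono nhdsWithin_le_nhds).and (self_mem_nhdsWithin (s := Iio (0 : ℝ)))).exists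
  have hy0 : y < 0 := hy0
  have h1 : f y < f 0 := hf.lt_of_lt_of_nonpos (by linarith) hy0 le_rfl
  have h2 := hf.lt_of_lt_of_nonneg hy.le h1 (hf.mapsTo ⟨by norm_num, by norm_num⟩).2
  have h3 := hR.lt_of_lt_of_nonpos (x := -(y / q)) (y := 0)
    (neg_le_neg ((div_le_one_of_neg hq).2 hyq.le))
    (neg_lt_zero.2 (div_pos_of_neg_of_neg hy0 hq)) le_rfl
  rw [renorm2_apply, renorm2_apply, mul_zero, show -q * -(y / q) = y by rw [neg_mul_neg, mul_div_cancel₀ _ hq.ne],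
    div_lt_div_right_of_neg hq] at h3
  linarith

lemma renorm_apply_zero_nonpos (hf : Unimodal f) (hq : q < 0) (h0 : f 0 ≤ 0) :
    Renorm2 f q 0 ≤ 0 := by
  have h1 := hf.2.1.monotoneOn ⟨(hf.mapsTo ⟨by norm_num, by norm_num⟩).1, h0⟩
    ⟨by norm_num, le_rfl⟩ h0
  rw [renorm2_apply, mul_zero]
  exact div_nonpos_of_nonneg_of_nonpos (by linarith) hq.le

lemma apply_eq_of_apply_apply_eq (hf : Unimodal f) (h0 : f 0 ≤ 0) {y : ℝ}
    (hy : y ∈ Icc (-1 : ℝ) 0) (hfy : f (f y) = y) : f y = y := by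
  have h1 : f y ≤ 0 := (hf.2.1.monotoneOn hy ⟨by norm_num, le_rfl⟩ hy.2).trans h0
  have h2 : -1 ≤ f y := (hf.mapsTo ⟨hy.1, hy.2.trans zero_le_one⟩).1
  rcases lt_trichotomy (f y) y with h | h | h
  · have := hf.lt_of_lt_of_nonpos h2 h hy.2
    linarith
  · exact h
  · have := hf.lt_of_lt_of_nonpos hy.1 h h1
    linarith

lemma apply_eq_of_renorm_apply_eq (hf : Unimodal f) (hq : q < 0) (hq1 : -1 < q) (h0 : f 0 ≤ 0)
    {y : ℝ} (hy : y ∈ Icc (-1 : ℝ) 0) (hfy : Renorm2 f q y = y) : f (-q * y) = -q * y := by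
  refine hf.apply_eq_of_apply_apply_eq h0 ⟨by nlinarith [hy.1, hy.2], by nlinarith [hy.2]⟩ ?_
  rw [renorm2_apply, div_eq_iff hq.ne] at hfy
  linarith

/-- If `f` expands cross-ratios on `[0,1]` and `f (f 0) < 0`, there is no point of period two
with nonnegative orbit. -/
lemma apply_eq_of_period_two (hf : Unimodal f)
    (hcr : ∀ w x y z : ℝ, 0 ≤ w → w < x → x < y → y < z → z ≤ 1 →
      crossRatio w x y z < crossRatio (f w) (f x) (f y) (f z))
    (hfc : f (f 0) < 0) {a b : ℝ} (ha : 0 ≤ a) (hab : a < b) (hb : b ≤ 1) (hfa : f a = b)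
    (hfb : f b = a) : False := by
  have hcont : ContinuousOn (fun x => f x - x) (Icc a b) :=
    (hf.1.mono (Icc_subset_Icc (by linarith) hb)).sub continuousOn_id
  obtain ⟨p, hp, hfp⟩ := intermediate_value_Ioo' hab.le hcont
    (show (0 : ℝ) ∈ Ioo (f b - b) (f a - a) by rw [hfa, hfb]; constructor <;> linarith)
  have hfp : f p = p := by simpa [sub_eq_zero] using hfp
  have ha0 : 0 < a := by
    refine ha.lt_of_ne ?_
    rintro rfl
    rw [hfa, hfb] at hfc
    exact lt_irrefl _ hfc
  have hbc : b < f 0 := hfa ▸ hf.lt_of_lt_of_nonneg le_rfl ha0 (by linarith)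
  have h1 := hcr 0 a p b le_rfl ha0 hp.1 hp.2 hb
  have h2 := hcr a p b (f 0) ha hp.1 hp.2 hbc (hf.mapsTo ⟨by norm_num, by norm_num⟩).2
  rw [hfa, hfb, hfp] at h1 h2
  rw [← crossRatio_reverse] at h2
  rw [← crossRatio_reverse (f 0)] at h1
  have h := h1.trans (by simpa only [crossRatio_reverse] using h2)
  simp only [crossRatio] at h
  have hp1 := hp.1
  have hp2 := hp.2
  rw [div_lt_div_iff₀ (by nlinarith) (by nlinarith)] at h
  have := mul_pos (mul_pos (sub_pos.2 hp1) (sub_pos.2 hp2))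
    (mul_pos (sub_pos.2 hab) (neg_pos.2 hfc))
  linarith

end Unimodal

section FeigSeq

variable {f : ℝ → ℝ} {t : ℝ} {fs : ℕ → ℝ → ℝ} {qs : ℕ → ℝ} {hs : ℕ → ℝ → ℝ}

lemma FeigSeq.renorm_unimodal (hseq : FeigSeq f fs qs) (k : ℕ) :
    Unimodal (Renorm2 (fs k) (qs k)) :=
  (hseq.2 k).2.2.2.2.2 ▸ (hseq.2 (k + 1)).1

lemma FeigSeq.neg_succ (hseq : FeigSeq f fs qs) {k : ℕ} (hk : qs k < 0) : qs (k + 1) < 0 := by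
  obtain ⟨hU, -, hq1, -, -, hfs⟩ := hseq.2 k
  obtain ⟨hU', hq', hq1', -⟩ := hseq.2 (k + 1)
  have h0 := hU.renorm_apply_zero_nonpos hk
    (hU.apply_zero_nonpos_of_renorm (hseq.renorm_unimodal k) hk (abs_lt.1 hq1).1)
  rw [← hfs] at h0
  by_contra! hpos
  have hpos : 0 < qs (k + 1) := hpos.lt_of_ne (abs_pos.1 hq').symm
  have h1 := hU'.apply_nonneg_of_renorm (hseq.renorm_unimodal (k + 1)) hpos (abs_lt.1 hq1').2
  have h2 := hU'.lt_of_lt_of_nonneg le_rfl hpos (abs_lt.1 hq1').2.le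
  linarith

lemma FeigSeq.pos (hseq : FeigSeq f fs qs) (ht : 1 < t)
    (hrep : ∀ n : ℕ, NegSchwDiffeo (hs n) ∧
      ∀ x ∈ Icc (-1 : ℝ) 1, fs n x = hs n (Qmap t x)) (k : ℕ) : 0 < qs k := by
  by_contra! hneg
  have hk0 : qs k < 0 := hneg.lt_of_ne (abs_pos.1 (hseq.2 k).2.1)
  have hk1 := hseq.neg_succ hk0
  have hk2 := hseq.neg_succ hk1
  have hlt : ∀ j, -1 < qs j := fun j => (abs_lt.1 (hseq.2 j).2.2.1).1
  have hz : ∀ j, qs j < 0 → fs j 0 ≤ 0 := fun j hj =>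
    (hseq.2 j).1.apply_zero_nonpos_of_renorm (hseq.renorm_unimodal j) hj (hlt j)
  have hfix : ∀ j, qs j < 0 → fs j (qs j) = qs j := fun j hj =>
    (hseq.2 j).1.apply_eq_of_apply_apply_eq (hz j hj) ⟨(hlt j).le, hj.le⟩ (hseq.2 j).2.2.2.1
  have hpull : ∀ j, qs j < 0 → ∀ y ∈ Icc (-1 : ℝ) 0, fs (j + 1) y = y →
      fs j (-qs j * y) = -qs j * y := fun j hj y hy h =>
    (hseq.2 j).1.apply_eq_of_renorm_apply_eq hj (hlt j) (hz j hj) hy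
      ((hseq.2 j).2.2.2.2.2 ▸ h)
  have hl0 := hlt k
  have hl1 := hlt (k + 1)
  have hl2 := hlt (k + 2)
  have e1 := hpull k hk0 _ ⟨hl1.le, hk1.le⟩ (hfix (k + 1) hk1)
  have e2 := hpull k hk0 _ ⟨by nlinarith, by nlinarith⟩
    (hpull (k + 1) hk1 _ ⟨hl2.le, hk2.le⟩ (hfix (k + 2) hk2))
  have e0 := hfix k hk0
  set b := qs k
  set c := -b * qs (k + 1) with hc
  set d := -b * (-qs (k + 1) * qs (k + 1 + 1)) with hd
  have hbc : b < c := by nlinarith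
  have hcd : c < d := by
    have : 0 < -b * -qs (k + 1) * (1 + qs (k + 1 + 1)) :=
      mul_pos (mul_pos (neg_pos.2 hk0) (neg_pos.2 hk1)) (by linarith)
    rw [hc, hd]
    linarith
  have hd0 : d < 0 := by
    have : 0 < -b * -qs (k + 1) * -qs (k + 1 + 1) :=
      mul_pos (mul_pos (neg_pos.2 hk0) (neg_pos.2 hk1)) (neg_pos.2 hk2)
    rw [hd]
    linarith
  have hU := (hseq.2 k).1
  have h := crossRatio_lt_of_unimodal ht hU (hrep k).1 (hrep k).2
    (w := -d) (x := -c) (y := -b) (z := 1) (by linarith) (by linarith) (by linarith)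
    (by linarith) le_rfl
  have heven := hU.2.2.2.1
  rw [heven d ⟨by linarith, by linarith⟩, heven c ⟨by linarith, by linarith⟩,
    heven b ⟨by linarith, by linarith⟩, e0, e1, e2, hU.2.2.2.2.2.1, ← crossRatio_neg] at h
  simp at h

lemma FeigSeq.apply_apply_zero_neg (hseq : FeigSeq f fs qs) (hpos : ∀ k, 0 < qs k) (k : ℕ) :
    fs k (fs k 0) < 0 := by
  have hq := hpos k
  have hq1 := (abs_lt.1 (hseq.2 (k + 1)).2.2.1).2
  have hU := (hseq.2 (k + 1)).1
  have h1 := hU.apply_nonneg_of_renorm (hseq.renorm_unimodal (k + 1)) (hpos (k + 1)) hq1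
  have h2 := hU.lt_of_lt_of_nonneg le_rfl (hpos (k + 1)) hq1.le
  have h3 : 0 < fs (k + 1) 0 := by linarith
  rw [(hseq.2 k).2.2.2.2.2, renorm2_apply, mul_zero] at h3
  have := (div_pos_iff_of_pos_right hq).1 h3
  linarith

lemma FeigSeq.apply_eq (hseq : FeigSeq f fs qs) (ht : 1 < t)
    (hrep : ∀ n : ℕ, NegSchwDiffeo (hs n) ∧
      ∀ x ∈ Icc (-1 : ℝ) 1, fs n x = hs n (Qmap t x)) (k : ℕ) : fs k (qs k) = qs k := by
  have hpos := hseq.pos ht hrep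
  have hU := (hseq.2 k).1
  have hq1 := (abs_lt.1 (hseq.2 k).2.2.1).2
  have hnn := hU.apply_nonneg_of_renorm (hseq.renorm_unimodal k) (hpos k) hq1
  have hqq : fs k (fs k (qs k)) = qs k := (hseq.2 k).2.2.2.1
  have hcr : ∀ w x y z : ℝ, 0 ≤ w → w < x → x < y → y < z → z ≤ 1 →
      crossRatio w x y z < crossRatio (fs k w) (fs k x) (fs k y) (fs k z) :=
    fun w x y z => crossRatio_lt_of_unimodal ht hU (hrep k).1 (hrep k).2
  have hfc := hseq.apply_apply_zero_neg hpos k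
  rcases lt_trichotomy (fs k (qs k)) (qs k) with h | h | h
  · exact (hU.apply_eq_of_period_two hcr hfc hnn h hq1.le hqq rfl).elim
  · exact h
  · exact (hU.apply_eq_of_period_two hcr hfc (hpos k).le h
      (hU.mapsTo ⟨by linarith [hpos k], hq1.le⟩).2 rfl hqq).elim

lemma FeigSeq.lt_apply_zero (hseq : FeigSeq f fs qs) (ht : 1 < t)
    (hrep : ∀ n : ℕ, NegSchwDiffeo (hs n) ∧
      ∀ x ∈ Icc (-1 : ℝ) 1, fs n x = hs n (Qmap t x)) (k : ℕ) : qs k < fs k 0 := by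
  have h := (hseq.2 k).1.lt_of_lt_of_nonneg le_rfl (hseq.pos ht hrep k)
    (abs_lt.1 (hseq.2 k).2.2.1).2.le
  rwa [hseq.apply_eq ht hrep k] at h

end FeigSeq

/-- `h` factors as `H ∘ h₀ ∘ (P · )` on `[-1,0]`, where `H` is an increasing homeomorphism from a
subinterval of `[-1,1]` onto `[α, β]` that does not contract cross-ratios. -/
def KoebeExtension (h₀ h : ℝ → ℝ) (P α β : ℝ) : Prop :=
  0 < P ∧ P ≤ 1 ∧ ∃ (H : ℝ → ℝ) (a b : ℝ), -1 ≤ a ∧ b ≤ 1 ∧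
    StrictMonoOn H (Icc a b) ∧ ContinuousOn H (Icc a b) ∧
    (∀ w x y z : ℝ, a ≤ w → w < x → x < y → y < z → z ≤ b →
      crossRatio w x y z ≤ crossRatio (H w) (H x) (H y) (H z)) ∧
    H a = α ∧ H b = β ∧
    ∀ x ∈ Icc (-1 : ℝ) 0, h₀ (P * x) ∈ Icc a b ∧ H (h₀ (P * x)) = h x

lemma exists_nonneg_qmap_eq {t x : ℝ} (ht : 1 < t) (hx : x ∈ Icc (-1 : ℝ) 0) :
    ∃ u ∈ Icc (0 : ℝ) 1, -(u ^ t) = x := by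
  have hx0 : 0 ≤ -x := by linarith [hx.2]
  refine ⟨(-x) ^ t⁻¹, ⟨Real.rpow_nonneg hx0 _,
    Real.rpow_le_one hx0 (by linarith [hx.1]) (inv_nonneg.2 (by linarith))⟩, ?_⟩
  rw [Real.rpow_inv_rpow hx0 (by linarith), neg_neg]

lemma NegSchwDiffeo.mapsTo_of_unimodal {f h : ℝ → ℝ} {t : ℝ} (ht : 1 < t) (hf : Unimodal f)
    (hfh : ∀ x ∈ Icc (-1 : ℝ) 1, f x = h (Qmap t x)) {x : ℝ} (hx : x ∈ Icc (-1 : ℝ) 0) :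
    h x ∈ Icc (-1 : ℝ) 1 := by
  obtain ⟨u, hu, rfl⟩ := exists_nonneg_qmap_eq ht hx
  have hu' : u ∈ Icc (-1 : ℝ) 1 := ⟨by linarith [hu.1], hu.2⟩
  rw [← qmap_of_nonneg hu.1, ← hfh u hu']
  exact hf.mapsTo hu'

lemma koebeExtension_self {f h : ℝ → ℝ} {t : ℝ} (ht : 1 < t) (hf : Unimodal f)
    (hfh : ∀ x ∈ Icc (-1 : ℝ) 1, f x = h (Qmap t x)) : KoebeExtension h h 1 (-1) 1 := by
  refine ⟨one_pos, le_rfl, id, -1, 1, le_rfl, le_rfl, strictMono_id.strictMonoOn _,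
    continuousOn_id, fun _ _ _ _ _ _ _ _ _ => le_rfl, rfl, rfl, fun x hx => ?_⟩
  rw [one_mul]
  exact ⟨NegSchwDiffeo.mapsTo_of_unimodal ht hf hfh hx, rfl⟩

lemma KoebeExtension.renorm {h₀ f h h' : ℝ → ℝ} {t q P α β : ℝ}
    (hE : KoebeExtension h₀ h P α β) (hα : α ≤ 0) (hβ : 1 ≤ β) (ht : 1 < t) (hf : Unimodal f)
    (hh : NegSchwDiffeo h) (hfh : ∀ x ∈ Icc (-1 : ℝ) 1, f x = h (Qmap t x))
    (hfh' : ∀ x ∈ Icc (-1 : ℝ) 1, Renorm2 f q x = h' (Qmap t x)) (hq : 0 < q) (hq1 : q < 1)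
    (hfq : f q = q) : KoebeExtension h₀ h' (P * q ^ t) (-(f 0) / q) (1 / q) := by
  obtain ⟨hP, hP1, H, a, b, ha, hb, hmono, hcont, hcr, hHa, hHb, hH⟩ := hE
  have hqt : 0 < q ^ t := Real.rpow_pos_of_pos hq t
  have hqt1 : q ^ t ≤ 1 := Real.rpow_le_one hq.le hq1.le (by linarith)
  have hab : a ≤ b := by
    have := (hH 0 (by norm_num)).1
    exact this.1.trans this.2
  obtain ⟨a', ha', hHa'⟩ := intermediate_value_Icc hab hcont
    (show (0 : ℝ) ∈ Icc (H a) (H b) by rw [hHa, hHb]; exact ⟨hα, by linarith⟩)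
  obtain ⟨b', hb', hHb'⟩ := intermediate_value_Icc hab hcont
    (show (1 : ℝ) ∈ Icc (H a) (H b) by rw [hHa, hHb]; exact ⟨by linarith, hβ⟩)
  have hsub : Icc a' b' ⊆ Icc a b := Icc_subset_Icc ha'.1 hb'.2
  have hmem : ∀ y ∈ Icc a' b', H y ∈ Icc (0 : ℝ) 1 := fun y hy =>
    ⟨hHa' ▸ hmono.monotoneOn ha' (hsub hy) hy.1, hHb' ▸ hmono.monotoneOn (hsub hy) hb' hy.2⟩
  refine ⟨mul_pos hP hqt, mul_le_one₀ hP1 hqt.le hqt1, fun y => -(f (H y)) / q, a', b',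
    ha.trans ha'.1, hb'.2.trans hb, ?_, ?_, ?_, ?_, ?_, ?_⟩
  · intro y hy z hz hyz
    have := hf.2.2.1 (hmem y hy) (hmem z hz) (hmono (hsub hy) (hsub hz) hyz)
    simp only
    gcongr
  · refine ContinuousOn.div_const (ContinuousOn.neg ?_) q
    exact (hf.1.mono (Icc_subset_Icc (by norm_num) le_rfl)).comp (hcont.mono hsub) hmem
  · intro w x y z hw hwx hxy hyz hz
    have hw' : w ∈ Icc a' b' := ⟨hw, by linarith⟩
    have hx' : x ∈ Icc a' b' := ⟨by linarith, by linarith⟩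
    have hy' : y ∈ Icc a' b' := ⟨by linarith, by linarith⟩
    have hz' : z ∈ Icc a' b' := ⟨by linarith, hz⟩
    rw [crossRatio_div _ _ _ _ hq.ne', crossRatio_neg]
    exact (hcr w x y z (hsub hw').1 hwx hxy hyz (hsub hz').2).trans
      (crossRatio_lt_of_unimodal ht hf hh hfh (hmem w hw').1
        (hmono (hsub hw') (hsub hx') hwx) (hmono (hsub hx') (hsub hy') hxy)
        (hmono (hsub hy') (hsub hz') hyz) (hmem z hz').2).le
  · simp only [hHa']
  · simp only [hHb', hf.2.2.2.2.2.1, neg_neg]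
  · intro x hx
    obtain ⟨u, hu, rfl⟩ := exists_nonneg_qmap_eq ht hx
    have hqu : q * u ∈ Icc (0 : ℝ) q := ⟨mul_nonneg hq.le hu.1, mul_le_of_le_one_right hq.le hu.2⟩
    have hqu' : q * u ∈ Icc (-1 : ℝ) 1 := ⟨by linarith [hqu.1], by linarith [hqu.2]⟩
    have hx' : q ^ t * -(u ^ t) ∈ Icc (-1 : ℝ) 0 := ⟨by nlinarith [hx.1, hx.2], by nlinarith [hx.2]⟩
    have hval : H (h₀ (P * (q ^ t * -(u ^ t)))) = f (q * u) := by
      rw [(hH _ hx').2, hfh _ hqu', qmap_of_nonneg hqu.1, Real.mul_rpow hq.le hu.1, mul_neg]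
    have hmem' := (hH _ hx').1
    have hge : q ≤ f (q * u) := by
      have := hf.2.2.1.antitoneOn ⟨hqu.1, hqu'.2⟩ ⟨hq.le, hq1.le⟩ hqu.2
      rwa [hfq] at this
    rw [mul_assoc]
    refine ⟨⟨?_, ?_⟩, ?_⟩
    · rw [← hmono.le_iff_le ha' hmem', hHa', hval]
      exact hq.le.trans hge
    · rw [← hmono.le_iff_le hmem' hb', hHb', hval]
      exact (hf.mapsTo hqu').2
    · have hu' : u ∈ Icc (-1 : ℝ) 1 := ⟨by linarith [hu.1], hu.2⟩
      simp only
      rw [hval, ← qmap_of_nonneg hu.1, ← hfh' u hu', renorm2_apply, neg_mul,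
        hf.2.2.2.1 _ hqu']

lemma KoebeExtension.le_of_apply_zero {h₀ f h : ℝ → ℝ} {t q P α β m M : ℝ}
    (hE : KoebeExtension h₀ h P α β) (hβ : 1 < β) (ht : 1 < t) (hf : Unimodal f)
    (hfh : ∀ x ∈ Icc (-1 : ℝ) 1, f x = h (Qmap t x)) (hq : 0 < q) (hqc : q < f 0)
    (hfq : f q = q) (hfc : f (f 0) < 0) (hm : 0 < m) (hM : 0 < M)
    (hLip : ∀ u ∈ Icc (-1 : ℝ) 0, ∀ v ∈ Icc (-1 : ℝ) 0, u ≤ v →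
      m * (v - u) ≤ h₀ v - h₀ u ∧ h₀ v - h₀ u ≤ M * (v - u)) :
    m / M * (1 - 1 / β) ≤ ((f 0 / q) ^ t - 1) * (f 0 / q - 1) := by
  obtain ⟨hP, hP1, H, a, b, ha, hb, hmono, hcont, hcr, hHa, hHb, hH⟩ := hE
  set c := f 0 with hcdef
  have hc1 : c ≤ 1 := (hf.mapsTo ⟨by norm_num, by norm_num⟩).2
  have hc0 : 0 < c := hq.trans hqc
  have hqt : 0 < q ^ t := Real.rpow_pos_of_pos hq t
  have hqct : q ^ t < c ^ t := Real.rpow_lt_rpow hq.le hqc (by linarith)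
  have hct1 : c ^ t ≤ 1 := Real.rpow_le_one hc0.le hc1 (by linarith)
  have hhc : h (-(c ^ t)) = f c := by
    rw [hfh c ⟨by linarith, hc1⟩, qmap_of_nonneg hc0.le]
  have hhq : h (-(q ^ t)) = q := by
    rw [← qmap_of_nonneg hq.le, ← hfh q ⟨by linarith, by linarith⟩, hfq]
  have hh0 : h 0 = c := by
    rw [hcdef, hfh 0 (by norm_num), qmap_of_nonneg le_rfl, Real.zero_rpow (by linarith), neg_zero]
  obtain ⟨m1, e1⟩ := hH (-(c ^ t)) ⟨by linarith, by linarith⟩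
  obtain ⟨m2, e2⟩ := hH (-(q ^ t)) ⟨by linarith, by linarith⟩
  obtain ⟨m3, e3⟩ := hH 0 (by norm_num)
  rw [hhc] at e1
  rw [hhq] at e2
  rw [hh0] at e3
  have hbm : b ∈ Icc a b := ⟨m1.1.trans m1.2, le_rfl⟩
  have l23 := hLip (P * -(q ^ t)) ⟨by nlinarith, by nlinarith⟩ (P * 0) (by norm_num) (by nlinarith)
  have l12 := hLip (P * -(c ^ t)) ⟨by nlinarith, by nlinarith⟩ (P * -(q ^ t))
    ⟨by nlinarith, by nlinarith⟩ (by nlinarith)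
  set y1 := h₀ (P * -(c ^ t))
  set y2 := h₀ (P * -(q ^ t))
  set y3 := h₀ (P * 0)
  have h12 : y1 < y2 := by rw [← hmono.lt_iff_lt m1 m2, e1, e2]; linarith
  have h23 : y2 < y3 := by rw [← hmono.lt_iff_lt m2 m3, e2, e3]; linarith
  have h3b : y3 < b := by rw [← hmono.lt_iff_lt m3 hbm, e3, hHb]; linarith
  have h := hcr y1 y2 y3 b m1.1 h12 h23 h3b le_rfl
  rw [e1, e2, e3, hHb] at h
  have hlow : m * q ^ t / (M * (c ^ t - q ^ t)) ≤ crossRatio y1 y2 y3 b := by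
    have i1 : m * q ^ t / (M * (c ^ t - q ^ t)) = P * (m * q ^ t) / (P * (M * (c ^ t - q ^ t))) :=
      (mul_div_mul_left _ _ hP.ne').symm
    rw [i1, crossRatio]
    calc P * (m * q ^ t) / (P * (M * (c ^ t - q ^ t))) ≤ (y3 - y2) / (y2 - y1) := by
          have := sub_pos.2 h12
          have := sub_pos.2 h23
          apply div_le_div₀ (by linarith) (by linarith [l23.1]) (by linarith)
          linarith [l12.2]
      _ ≤ (b - y1) * (y3 - y2) / ((y2 - y1) * (b - y3)) := by
          rw [div_le_div_iff₀ (by linarith) (mul_pos (by linarith) (by linarith))]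
          have := mul_pos (mul_pos (sub_pos.2 h23) (sub_pos.2 h12))
            (show 0 < y3 - y1 by linarith)
          linarith
  have hup : crossRatio (f c) q c β ≤ β * (c - q) / (q * (β - c)) := by
    rw [crossRatio, div_le_div_iff₀ (mul_pos (by linarith) (by linarith))
      (mul_pos hq (by linarith))]
    have := mul_nonneg (mul_nonneg (mul_nonneg (show 0 ≤ c - q by linarith)
      (show 0 ≤ β - c by linarith)) (show 0 ≤ β - q by linarith)) (neg_pos.2 hfc).le
    linarith
  have hfin := (hlow.trans h).trans hup
  rw [div_le_div_iff₀ (mul_pos hM (by linarith)) (mul_pos hq (by linarith))] at hfin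
  have hβc : 1 - 1 / β ≤ (β - c) / β := by
    rw [sub_div, div_self (by linarith)]
    gcongr
  calc m / M * (1 - 1 / β) ≤ m / M * ((β - c) / β) := by gcongr
    _ ≤ ((c / q) ^ t - 1) * (c / q - 1) := by
        have e : ((c / q) ^ t - 1) * (c / q - 1) = (c ^ t - q ^ t) * (c - q) / (q ^ t * q) := by
          rw [Real.div_rpow hc0.le hq.le]
          field_simp
        rw [e, div_mul_div_comm, div_le_div_iff₀ (by positivity) (by positivity)]
        linarith

lemma exists_one_lt_le_of_recursion {r : ℕ → ℝ} {κ t : ℝ} (hκ : 0 < κ) (ht : 1 < t)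
    (hr : ∀ n, 1 < r n)
    (hrec : ∀ n, κ * (1 - 1 / r n) ≤ (r (n + 1) ^ t - 1) * (r (n + 1) - 1)) :
    ∃ ρ, 1 < ρ ∧ ∀ n, ρ ≤ r n := by
  have hc : ContinuousAt (fun ρ : ℝ => ρ * (ρ ^ t - 1)) 1 :=
    continuousAt_id.mul ((Real.continuousAt_rpow_const _ _ (Or.inl one_ne_zero)).sub
      continuousAt_const)
  have hev : ∀ᶠ ρ in nhds (1 : ℝ), ρ * (ρ ^ t - 1) < κ ∧ ρ < r 0 :=
    (hc.eventually_lt_const (by simpa using hκ)).and (gt_mem_nhds (hr 0))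
  obtain ⟨ρ, ⟨hρκ, hρ0⟩, hρ1⟩ :=
    ((hev.filter_mono nhdsWithin_le_nhds).and (self_mem_nhdsWithin (s := Ioi (1 : ℝ)))).exists
  have hρ1 : 1 < ρ := hρ1
  refine ⟨ρ, hρ1, fun n => ?_⟩
  induction n with
  | zero => exact hρ0.le
  | succ n ih =>
    by_contra! hlt
    have h1 := hr (n + 1)
    have h2 : κ * (1 - 1 / ρ) ≤ κ * (1 - 1 / r n) := by gcongr
    have h3 : r (n + 1) ^ t - 1 ≤ ρ ^ t - 1 := by gcongr
    have h4 : 0 < r (n + 1) ^ t - 1 := sub_pos.2 (Real.one_lt_rpow h1 (by linarith))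
    have h5 : (r (n + 1) ^ t - 1) * (r (n + 1) - 1) ≤ (ρ ^ t - 1) * (ρ - 1) := by
      apply mul_le_mul h3 (by linarith) (by linarith) (by linarith)
    have h6 : κ * (1 - 1 / ρ) * ρ = κ * (ρ - 1) := by field_simp
    have h7 : κ * (ρ - 1) ≤ ρ * (ρ ^ t - 1) * (ρ - 1) := by
      rw [← h6]
      calc _ ≤ (ρ ^ t - 1) * (ρ - 1) * ρ := by
            have := (h2.trans (hrec n)).trans h5
            gcongr
        _ = _ := by ring
    have h8 := mul_lt_mul_of_pos_right hρκ (sub_pos.2 hρ1)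
    linarith


section KoebeNonlinearity

open Filter Topology

lemma tendsto_sub_div_sub {g h : ℝ → ℝ} {g' h' x : ℝ} (hg : HasDerivAt g g' x)
    (hh : HasDerivAt h h' x) (hg' : g' ≠ 0) :
    Tendsto (fun u => (h u - h x) / (g u - g x)) (𝓝[≠] x) (𝓝 (h' / g')) := by
  refine (hh.tendsto_slope.div hg.tendsto_slope hg').congr' ?_
  filter_upwards [self_mem_nhdsWithin] with u hu
  have hu' : u - x ≠ 0 := sub_ne_zero.2 hu
  simp only [Pi.div_apply, slope_def_field]
  exact div_div_div_cancel_right₀ hu' _ _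

/-- Nonlinearity measures the second order defect of `1 / (g u - g x)`. -/
lemma tendsto_inv_sub_inv_of_hasDerivAt {g : ℝ → ℝ} {g₂ x : ℝ}
    (hd : ∀ᶠ u in 𝓝 x, DifferentiableAt ℝ g u) (hg₂ : HasDerivAt (deriv g) g₂ x)
    (hg' : deriv g x ≠ 0) :
    Tendsto (fun u => 1 / (deriv g x * (u - x)) - 1 / (g u - g x)) (𝓝[≠] x)
      (𝓝 (g₂ / deriv g x ^ 2 / 2)) := by
  set c := deriv g x with hc
  have hgx : HasDerivAt g c x := hd.self_of_nhds.hasDerivAt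
  have hne : ∀ᶠ u in 𝓝[≠] x, u - x ≠ 0 := by
    filter_upwards [self_mem_nhdsWithin] with u hu using sub_ne_zero.2 hu
  have h1 : Tendsto (fun u => (g u - g x - c * (u - x)) / (u - x) ^ 2) (𝓝[≠] x)
      (𝓝 (g₂ / 2)) := by
    refine HasDerivAt.lhopital_zero_nhdsNE (f' := fun u => deriv g u - c)
      (g' := fun u => 2 * (u - x)) ?_ ?_ ?_ ?_ ?_ ?_
    · filter_upwards [hd.filter_mono nhdsWithin_le_nhds] with u hu
      exact ((hu.hasDerivAt.sub_const (g x)).sub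
        (((hasDerivAt_id u).sub_const x).const_mul c)).congr_deriv (by ring)
    · refine Eventually.of_forall fun u => ?_
      exact (((hasDerivAt_id u).sub_const x).pow 2).congr_deriv (by simp)
    · filter_upwards [hne] with u hu using mul_ne_zero two_ne_zero hu
    · have : ContinuousAt (fun u => g u - g x - c * (u - x)) x :=
        (hgx.continuousAt.sub continuousAt_const).sub (by fun_prop)
      simpa using this.tendsto.mono_left nhdsWithin_le_nhds
    · have : ContinuousAt (fun u => (u - x) ^ 2) x := by fun_prop
      simpa using this.tendsto.mono_left nhdsWithin_le_nhds
    · refine (hg₂.tendsto_slope.div_const 2).congr' ?_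
      filter_upwards [hne] with u hu
      rw [slope_def_field, ← hc]
      field_simp
  have h2 : Tendsto (fun u => c * slope g x u) (𝓝[≠] x) (𝓝 (c * c)) :=
    hgx.tendsto_slope.const_mul c
  have h3 := h1.div h2 (mul_ne_zero hg' hg')
  have e : g₂ / 2 / (c * c) = g₂ / c ^ 2 / 2 := by field_simp
  rw [e] at h3
  refine h3.congr' ?_
  filter_upwards [hne, hgx.tendsto_slope.eventually_ne hg'] with u hu hs
  have hs' : g u - g x ≠ 0 := by
    rw [slope_def_field] at hs
    exact fun h0 => hs (by rw [h0, zero_div])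
  simp only [Pi.div_apply, slope_def_field]
  field_simp

/-- The Koebe principle: a map `h = H ∘ g` that extends with room `δ` through an `H` not
contracting cross-ratios has controlled second order defect. -/
lemma inv_sub_inv_bounds {g h : ℝ → ℝ} {g' h' x a b α β : ℝ} (hg : HasDerivAt g g' x)
    (hh : HasDerivAt h h' x) (hg' : 0 < g') (hh' : 0 < h')
    {s : Set ℝ} (hs : s ∈ 𝓝 x) (hgs : StrictMonoOn g s) (hhs : StrictMonoOn h s)
    (hgab : ∀ u ∈ s, g u ∈ Ioo a b) (hhαβ : ∀ u ∈ s, h u ∈ Ioo α β)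
    (hr : ∀ u ∈ s, ∀ v ∈ s, ∀ w ∈ s, u < v → v < w →
      crossRatio (g u) (g v) (g w) b ≤ crossRatio (h u) (h v) (h w) β)
    (hl : ∀ u ∈ s, ∀ v ∈ s, ∀ w ∈ s, u < v → v < w →
      crossRatio a (g u) (g v) (g w) ≤ crossRatio α (h u) (h v) (h w))
    (hm : ∀ u ∈ s, ∀ v ∈ s, u < v →
      crossRatio a (g u) (g v) b ≤ crossRatio α (h u) (h v) β) :
    (b - a) / ((g x - a) * (b - g x)) ≤ h' / g' * ((β - α) / ((h x - α) * (β - h x))) ∧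
    (∀ᶠ u in 𝓝[>] x, 1 / (h u - h x) - 1 / (β - h x) ≤
      g' / h' * (1 / (g u - g x) - 1 / (b - g x))) ∧
    (∀ᶠ u in 𝓝[<] x, 1 / (h x - h u) - 1 / (h x - α) ≤
      g' / h' * (1 / (g x - g u) - 1 / (g x - a))) := by
  have hlim := tendsto_sub_div_sub hg hh hg'.ne'
  have hD : 0 < h' / g' := div_pos hh' hg'
  have hlr := hlim.mono_left (nhdsGT_le_nhdsNE x)
  have hll := hlim.mono_left (nhdsLT_le_nhdsNE x)
  have xs : x ∈ s := mem_of_mem_nhds hs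
  obtain ⟨xa, xb⟩ := hgab x xs
  obtain ⟨xα, xβ⟩ := hhαβ x xs
  have hgr := hg.continuousAt.tendsto.mono_left (nhdsWithin_le_nhds (s := Ioi x))
  have hhr := hh.continuousAt.tendsto.mono_left (nhdsWithin_le_nhds (s := Ioi x))
  have hgl := hg.continuousAt.tendsto.mono_left (nhdsWithin_le_nhds (s := Iio x))
  have hhl := hh.continuousAt.tendsto.mono_left (nhdsWithin_le_nhds (s := Iio x))
  refine ⟨?_, ?_, ?_⟩
  · have t1 : Tendsto (fun v => (b - a) / ((g x - a) * (b - g v))) (𝓝[>] x)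
        (𝓝 ((b - a) / ((g x - a) * (b - g x)))) :=
      tendsto_const_nhds.div (tendsto_const_nhds.mul (tendsto_const_nhds.sub hgr))
        (mul_ne_zero (by linarith) (by linarith))
    have t2 : Tendsto (fun v => (h v - h x) / (g v - g x) *
        ((β - α) / ((h x - α) * (β - h v)))) (𝓝[>] x)
        (𝓝 (h' / g' * ((β - α) / ((h x - α) * (β - h x))))) :=
      hlr.mul (tendsto_const_nhds.div (tendsto_const_nhds.mul (tendsto_const_nhds.sub hhr))
        (mul_ne_zero (by linarith) (by linarith)))
    refine le_of_tendsto_of_tendsto t1 t2 ?_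
    filter_upwards [self_mem_nhdsWithin, mem_nhdsWithin_of_mem_nhds hs]
      with v hv vs
    obtain ⟨va, vb⟩ := hgab v vs
    obtain ⟨vα, vβ⟩ := hhαβ v vs
    have k1 := hgs xs vs hv
    have k2 := hhs xs vs hv
    have := hm x xs v vs hv
    unfold crossRatio at this
    have p1 : 0 < g v - g x := sub_pos.2 k1
    calc (b - a) / ((g x - a) * (b - g v))
        = (b - a) * (g v - g x) / ((g x - a) * (b - g v)) / (g v - g x) := by field_simp
      _ ≤ (β - α) * (h v - h x) / ((h x - α) * (β - h v)) / (g v - g x) := by gcongr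
      _ = _ := by field_simp
  · filter_upwards [self_mem_nhdsWithin, mem_nhdsWithin_of_mem_nhds hs]
      with u hu us
    obtain ⟨ua, ub⟩ := hgab u us
    obtain ⟨uα, uβ⟩ := hhαβ u us
    have k1 := hgs xs us hu
    have k2 := hhs xs us hu
    have key : h' / g' * ((b - g x) * (g u - g x) / (b - g u)) ≤
        (β - h x) * (h u - h x) / (β - h u) := by
      have t1 : Tendsto (fun v => (h v - h x) / (g v - g x) *
          ((b - g x) * (g u - g v) / (b - g u))) (𝓝[>] x)
          (𝓝 (h' / g' * ((b - g x) * (g u - g x) / (b - g u)))) :=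
        hlr.mul ((tendsto_const_nhds.mul (tendsto_const_nhds.sub hgr)).div_const _)
      have t2 : Tendsto (fun v => (β - h x) * (h u - h v) / (β - h u)) (𝓝[>] x)
          (𝓝 ((β - h x) * (h u - h x) / (β - h u))) :=
        (tendsto_const_nhds.mul (tendsto_const_nhds.sub hhr)).div_const _
      refine le_of_tendsto_of_tendsto t1 t2 ?_
      filter_upwards [self_mem_nhdsWithin, mem_nhdsWithin_of_mem_nhds hs,
        mem_nhdsWithin_of_mem_nhds (Iio_mem_nhds (mem_Ioi.1 hu))]
        with v hv vs hvu
      have l1 := hgs xs vs hv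
      have l2 := hhs xs vs hv
      have l3 := hgs vs us hvu
      have := hr x xs v vs u us hv hvu
      unfold crossRatio at this
      have p1 : 0 < g v - g x := sub_pos.2 l1
      have p2 : 0 < h v - h x := sub_pos.2 l2
      calc (h v - h x) / (g v - g x) * ((b - g x) * (g u - g v) / (b - g u))
          = (b - g x) * (g u - g v) / ((g v - g x) * (b - g u)) * (h v - h x) := by field_simp
        _ ≤ (β - h x) * (h u - h v) / ((h v - h x) * (β - h u)) * (h v - h x) := by gcongr
        _ = _ := by field_simp
    have p1 : 0 < g u - g x := sub_pos.2 k1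
    have p2 : 0 < h u - h x := sub_pos.2 k2
    have p3 : 0 < b - g u := sub_pos.2 ub
    have p4 : 0 < β - h u := sub_pos.2 uβ
    have p5 : 0 < b - g x := by linarith
    have p6 : 0 < β - h x := by linarith
    have e1 : 1 / (h u - h x) - 1 / (β - h x) =
        ((β - h x) * (h u - h x) / (β - h u))⁻¹ := by field_simp; ring
    have e2 : g' / h' * (1 / (g u - g x) - 1 / (b - g x)) =
        (h' / g' * ((b - g x) * (g u - g x) / (b - g u)))⁻¹ := by field_simp; ring
    rw [e1, e2]
    exact inv_anti₀ (by positivity) key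
  · filter_upwards [self_mem_nhdsWithin, mem_nhdsWithin_of_mem_nhds hs]
      with u hu us
    obtain ⟨ua, ub⟩ := hgab u us
    obtain ⟨uα, uβ⟩ := hhαβ u us
    have k1 := hgs us xs hu
    have k2 := hhs us xs hu
    have key : h' / g' * ((g x - a) * (g x - g u) / (g u - a)) ≤
        (h x - α) * (h x - h u) / (h u - α) := by
      have t1 : Tendsto (fun v => (h v - h x) / (g v - g x) *
          ((g x - a) * (g v - g u) / (g u - a))) (𝓝[<] x)
          (𝓝 (h' / g' * ((g x - a) * (g x - g u) / (g u - a)))) :=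
        hll.mul ((tendsto_const_nhds.mul (hgl.sub tendsto_const_nhds)).div_const _)
      have t2 : Tendsto (fun v => (h x - α) * (h v - h u) / (h u - α)) (𝓝[<] x)
          (𝓝 ((h x - α) * (h x - h u) / (h u - α))) :=
        (tendsto_const_nhds.mul (hhl.sub tendsto_const_nhds)).div_const _
      refine le_of_tendsto_of_tendsto t1 t2 ?_
      filter_upwards [self_mem_nhdsWithin, mem_nhdsWithin_of_mem_nhds hs,
        mem_nhdsWithin_of_mem_nhds (Ioi_mem_nhds (mem_Iio.1 hu))]
        with v hv vs hvu
      have l1 := hgs vs xs hv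
      have l2 := hhs vs xs hv
      have l3 := hgs us vs hvu
      have := hl u us v vs x xs hvu hv
      unfold crossRatio at this
      have p1 : 0 < g x - g v := sub_pos.2 l1
      have p2 : 0 < h x - h v := sub_pos.2 l2
      rw [← neg_sub (h x), ← neg_sub (g x) (g v), neg_div_neg_eq]
      calc (h x - h v) / (g x - g v) * ((g x - a) * (g v - g u) / (g u - a))
          = (g x - a) * (g v - g u) / ((g u - a) * (g x - g v)) * (h x - h v) := by field_simp
        _ ≤ (h x - α) * (h v - h u) / ((h u - α) * (h x - h v)) * (h x - h v) := by gcongr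
        _ = _ := by field_simp
    have p1 : 0 < g x - g u := sub_pos.2 k1
    have p2 : 0 < h x - h u := sub_pos.2 k2
    have p3 : 0 < g u - a := sub_pos.2 ua
    have p4 : 0 < h u - α := sub_pos.2 uα
    have p5 : 0 < g x - a := by linarith
    have p6 : 0 < h x - α := by linarith
    have e1 : 1 / (h x - h u) - 1 / (h x - α) =
        ((h x - α) * (h x - h u) / (h u - α))⁻¹ := by field_simp; ring
    have e2 : g' / h' * (1 / (g x - g u) - 1 / (g x - a)) =
        (h' / g' * ((g x - a) * (g x - g u) / (g u - a)))⁻¹ := by field_simp; ring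
    rw [e1, e2]
    exact inv_anti₀ (by positivity) key

lemma KoebeExtension.abs_nonlin_le {h₀ h : ℝ → ℝ} {P α β δ C : ℝ}
    (hE : KoebeExtension h₀ h P α β) (hδ : 0 < δ) (hα : α ≤ -(1 + δ)) (hβ : 1 + δ ≤ β)
    (hh₀ : NegSchwDiffeo h₀) (hh : NegSchwDiffeo h)
    (hmaps : ∀ x ∈ Icc (-1 : ℝ) 0, h x ∈ Icc (-1 : ℝ) 1)
    (hC : ∀ x ∈ Icc (-1 : ℝ) 0, |Nonlin h₀ x| ≤ C) {x : ℝ} (hx : x ∈ Icc (-1 : ℝ) 0) :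
    |Nonlin h x| ≤ 2 / δ + 2 * C / δ := by
  refine hh.abs_nonlin_le_of_Ioo (fun x hx => ?_) hx
  obtain ⟨hP, hP1, H, a, b, ha, hb, hmono, -, hcr, hHa, hHb, hH⟩ := hE
  have hxI := Ioo_subset_Icc_self hx
  have hPm : ∀ u ∈ Ioo (-1 : ℝ) 0, P * u ∈ Ioo (-1 : ℝ) 0 := fun u hu =>
    ⟨by nlinarith [hu.1, hu.2], by nlinarith [hu.1, hu.2]⟩
  have hPc : ∀ u ∈ Icc (-1 : ℝ) 0, P * u ∈ Icc (-1 : ℝ) 0 := fun u hu =>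
    ⟨by nlinarith [hu.1, hu.2], by nlinarith [hu.1, hu.2]⟩
  set g : ℝ → ℝ := fun u => h₀ (P * u) with hg
  have hgm : StrictMonoOn g (Icc (-1) 0) := fun u hu v hv huv =>
    hh₀.strictMonoOn (hPc u hu) (hPc v hv) (by gcongr)
  have hgab : ∀ u ∈ Ioo (-1 : ℝ) 0, g u ∈ Ioo a b := fun u hu => by
    have hu' := Ioo_subset_Icc_self hu
    exact ⟨(hH (-1) (by norm_num)).1.1.trans_lt (hgm (by norm_num) hu' hu.1),
      (hgm hu' (by norm_num) hu.2).trans_le (hH 0 (by norm_num)).1.2⟩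
  have hPd : ∀ u : ℝ, HasDerivAt (fun u => P * u) P u := fun u =>
    ((hasDerivAt_id u).const_mul P).congr_deriv (mul_one P)
  have hgd : ∀ u ∈ Ioo (-1 : ℝ) 0, HasDerivAt g (deriv h₀ (P * u) * P) u := fun u hu =>
    (hh₀.differentiableAt (hPc u (Ioo_subset_Icc_self hu))).hasDerivAt.comp u (hPd u)
  have hIoo : Ioo (-1 : ℝ) 0 ∈ 𝓝 x := Ioo_mem_nhds hx.1 hx.2
  have hg₂ : HasDerivAt (deriv g) (deriv (deriv h₀) (P * x) * P * P) x := by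
    have h1 : HasDerivAt (fun u => deriv h₀ (P * u) * P)
        (deriv (deriv h₀) (P * x) * P * P) x :=
      ((((hh₀.contDiffAt_deriv (hPm x hx)).differentiableAt (by norm_num)).hasDerivAt).comp x
        (hPd x)).mul_const P
    refine h1.congr_of_eventuallyEq ?_
    filter_upwards [hIoo] with u hu using (hgd u hu).deriv
  have hgx := (hgd x hx).deriv
  have hg₀ : 0 < deriv h₀ (P * x) := hh₀.2.1 _ (hPc x hxI)
  have hg' : 0 < deriv g x := by rw [hgx]; positivity
  have hh' : 0 < deriv h x := hh.2.1 x hxI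
  have hNg : deriv (deriv h₀) (P * x) * P * P / deriv g x ^ 2 = Nonlin h₀ (P * x) := by
    rw [hgx, Nonlin]
    field_simp
  have limg := tendsto_inv_sub_inv_of_hasDerivAt
    (by filter_upwards [hIoo] with u hu using (hgd u hu).differentiableAt) hg₂ hg'.ne'
  rw [hNg] at limg
  have limh := tendsto_inv_sub_inv_of_hasDerivAt
    (by filter_upwards [hIoo] with u hu using hh.differentiableAt (Ioo_subset_Icc_self hu))
    ((hh.contDiffAt_deriv hx).differentiableAt (by norm_num)).hasDerivAt hh'.ne'
  change Tendsto _ _ (𝓝 (Nonlin h x / 2)) at limh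
  have hHg : ∀ u ∈ Ioo (-1 : ℝ) 0, H (g u) = h u := fun u hu =>
    (hH u (Ioo_subset_Icc_self hu)).2
  have hgm' := hgm.mono Ioo_subset_Icc_self
  have hαβ : ∀ u ∈ Ioo (-1 : ℝ) 0, h u ∈ Ioo α β := fun u hu => by
    obtain ⟨h1, h2⟩ := hmaps u (Ioo_subset_Icc_self hu)
    exact ⟨by linarith, by linarith⟩
  obtain ⟨hmid, hright, hleft⟩ := inv_sub_inv_bounds (a := a) (b := b) (α := α) (β := β)
    (hgd x hx).differentiableAt.hasDerivAt (hh.differentiableAt hxI).hasDerivAt hg' hh' hIoo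
    hgm' (hh.strictMonoOn.mono Ioo_subset_Icc_self) hgab hαβ
    (fun u hu v hv w hw huv hvw => by
      have := hcr _ _ _ _ (hgab u hu).1.le (hgm' hu hv huv) (hgm' hv hw hvw) (hgab w hw).2 le_rfl
      rwa [hHg u hu, hHg v hv, hHg w hw, hHb] at this)
    (fun u hu v hv w hw huv hvw => by
      have := hcr _ _ _ _ le_rfl (hgab u hu).1 (hgm' hu hv huv) (hgm' hv hw hvw) (hgab w hw).2.le
      rwa [hHg u hu, hHg v hv, hHg w hw, hHa] at this)
    (fun u hu v hv huv => by
      have := hcr _ _ _ _ le_rfl (hgab u hu).1 (hgm' hu hv huv) (hgab v hv).2 le_rfl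
      rwa [hHg u hu, hHg v hv, hHa, hHb] at this)
  obtain ⟨xa, xb⟩ := hgab x hx
  obtain ⟨xm, xM⟩ := hmaps x hxI
  have pa : 0 < g x - a := sub_pos.2 xa
  have pb : 0 < b - g x := sub_pos.2 xb
  have rα : 1 / (h x - α) ≤ 1 / δ := one_div_le_one_div_of_le hδ (by linarith)
  have rβ : 1 / (β - h x) ≤ 1 / δ := one_div_le_one_div_of_le hδ (by linarith)
  have qα : 0 < h x - α := by linarith
  have qβ : 0 < β - h x := by linarith
  have hD : deriv g x / deriv h x ≤ 2 / δ := by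
    have e1 : (b - a) / ((g x - a) * (b - g x)) = 1 / (b - g x) + 1 / (g x - a) := by
      field_simp; ring
    have e2 : (β - α) / ((h x - α) * (β - h x)) = 1 / (β - h x) + 1 / (h x - α) := by
      field_simp; ring
    rw [e1, e2] at hmid
    have b1 : 1 / 2 ≤ 1 / (b - g x) := one_div_le_one_div_of_le pb (by linarith)
    have b2 : 1 / 2 ≤ 1 / (g x - a) := one_div_le_one_div_of_le pa (by linarith)
    have b3 : 1 ≤ deriv h x / deriv g x * (2 / δ) := by
      calc (1 : ℝ) ≤ _ := by linarith
        _ ≤ _ := hmid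
        _ ≤ _ := by
          gcongr
          linarith [show 2 / δ = 1 / δ + 1 / δ by ring]
    calc deriv g x / deriv h x = deriv g x / deriv h x * 1 := (mul_one _).symm
      _ ≤ deriv g x / deriv h x * (deriv h x / deriv g x * (2 / δ)) := by gcongr
      _ = 2 / δ := by field_simp
  set E := deriv g x / deriv h x with hE
  have hE0 : 0 < E := div_pos hg' hh'
  have lower : E * (Nonlin h₀ (P * x) / 2) - 1 / δ ≤ Nonlin h x / 2 := by
    refine le_of_tendsto_of_tendsto (((limg.mono_left (nhdsGT_le_nhdsNE x)).const_mul E).sub_const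
      (1 / δ)) (limh.mono_left (nhdsGT_le_nhdsNE x)) ?_
    filter_upwards [hright, self_mem_nhdsWithin] with u hu hux
    have hux' : u - x ≠ 0 := (sub_pos.2 hux).ne'
    have e : E * (1 / (deriv g x * (u - x))) = 1 / (deriv h x * (u - x)) := by
      rw [hE]; field_simp
    have : 0 < E * (1 / (b - g x)) := by positivity
    rw [mul_sub E] at hu ⊢
    linarith
  have upper : Nonlin h x / 2 ≤ E * (Nonlin h₀ (P * x) / 2) + 1 / δ := by
    refine le_of_tendsto_of_tendsto (limh.mono_left (nhdsLT_le_nhdsNE x))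
      (((limg.mono_left (nhdsLT_le_nhdsNE x)).const_mul E).add_const (1 / δ)) ?_
    filter_upwards [hleft, self_mem_nhdsWithin] with u hu hux
    have hux' : u - x ≠ 0 := (sub_neg.2 hux).ne
    have e : E * (1 / (deriv g x * (u - x))) = 1 / (deriv h x * (u - x)) := by
      rw [hE]; field_simp
    have : 0 < E * (1 / (g x - a)) := by positivity
    have f1 : 1 / (g x - g u) = -(1 / (g u - g x)) := by rw [← neg_sub, one_div_neg_eq_neg_one_div]
    have f2 : 1 / (h x - h u) = -(1 / (h u - h x)) := by rw [← neg_sub, one_div_neg_eq_neg_one_div]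
    rw [f1, f2, mul_sub, mul_neg] at hu
    rw [mul_sub E]
    linarith
  have hN := hC _ (hPc x hxI)
  have hEN : |E * Nonlin h₀ (P * x)| ≤ 2 * C / δ := by
    rw [abs_mul, abs_of_pos hE0]
    calc E * |Nonlin h₀ (P * x)| ≤ 2 / δ * C := by gcongr
      _ = _ := by ring
  rw [abs_le] at hEN ⊢
  have : 2 / δ = 2 * (1 / δ) := by ring
  constructor <;> linarith [hEN.1, hEN.2]

end KoebeNonlinearity

/-- **Lemma 4 (a priori bound).** If `f = h ∘ Q_t` is a Feigenbaum map in `𝒰`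
and `fs n = hs n ∘ Q_t` is its `n`-th renormalization, then there is
`C₄ = C₄(f) > 0` with `|N(hs n) x| ≤ C₄` for all `x ∈ [-1,0]` and `n ≥ 0`. -/
theorem lemma4_a_priori_bound (f : ℝ → ℝ) (t : ℝ) (fs : ℕ → ℝ → ℝ)
    (qs : ℕ → ℝ) (hs : ℕ → ℝ → ℝ)
    (ht : 1 < t) (hfU : Unimodal f) (hseq : FeigSeq f fs qs)
    (hrep : ∀ n : ℕ, NegSchwDiffeo (hs n) ∧
      ∀ x ∈ Icc (-1 : ℝ) 1, fs n x = hs n (Qmap t x)) :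
    ∃ C₄ > 0, ∀ n : ℕ, ∀ x ∈ Icc (-1 : ℝ) 0, |Nonlin (hs n) x| ≤ C₄ := by
  have hpos := fun k => hseq.pos ht hrep k
  have hfix := fun k => hseq.apply_eq ht hrep k
  have hlt := fun k => hseq.lt_apply_zero ht hrep k
  have hneg := fun k => hseq.apply_apply_zero_neg hpos k
  have hq1 : ∀ k, qs k < 1 := fun k => (abs_lt.1 (hseq.2 k).2.2.1).2
  have hU : ∀ k, Unimodal (fs k) := fun k => (hseq.2 k).1
  have hstep : ∀ k, ∀ x ∈ Icc (-1 : ℝ) 1, Renorm2 (fs k) (qs k) x = hs (k + 1) (Qmap t x) :=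
    fun k x hx => by rw [← (hseq.2 k).2.2.2.2.2]; exact (hrep (k + 1)).2 x hx
  have hext : ∀ n, ∃ P, KoebeExtension (hs 0) (hs (n + 1)) P (-(fs n 0) / qs n) (1 / qs n) := by
    intro n
    induction n with
    | zero =>
      exact ⟨_, (koebeExtension_self ht (hU 0) (hrep 0).2).renorm (by norm_num) le_rfl ht (hU 0)
        (hrep 0).1 (hrep 0).2 (hstep 0) (hpos 0) (hq1 0) (hfix 0)⟩
    | succ n ih =>
      obtain ⟨P, hP⟩ := ih
      have h0 : 0 ≤ fs n 0 := ((hpos n).trans (hlt n)).le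
      exact ⟨_, hP.renorm (div_nonpos_of_nonpos_of_nonneg (neg_nonpos.2 h0) (hpos n).le)
        ((one_le_div (hpos n)).2 (hq1 n).le) ht (hU _) (hrep _).1 (hrep _).2 (hstep _) (hpos _)
        (hq1 _) (hfix _)⟩
  have hc1 : ∀ k, fs k 0 ≤ 1 := fun k => ((hU k).mapsTo ⟨by norm_num, by norm_num⟩).2
  obtain ⟨m, M, hm, hmM, hLip⟩ := (hrep 0).1.exists_biLipschitz
  have hM : 0 < M := hm.trans_le hmM
  obtain ⟨ρ, hρ, hle⟩ := exists_one_lt_le_of_recursion (r := fun n => fs n 0 / qs n)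
    (div_pos hm hM) ht (fun n => (one_lt_div (hpos n)).2 (hlt n)) (fun n => by
      obtain ⟨P, hP⟩ := hext n
      refine le_trans ?_ (hP.le_of_apply_zero ((one_lt_div (hpos n)).2 (hq1 n)) ht (hU (n + 1))
        (hrep (n + 1)).2 (hpos _) (hlt _) (hfix _) (hneg _) hm hM hLip)
      have h0 : 0 < fs n 0 := (hpos n).trans (hlt n)
      have hq := hpos n
      have : 1 / (1 / qs n) ≤ 1 / (fs n 0 / qs n) :=
        one_div_le_one_div_of_le (div_pos h0 hq) (by gcongr; exact hc1 n)
      gcongr)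
  obtain ⟨C, hC⟩ := (hrep 0).1.exists_abs_nonlin_le
  have hδ : 0 < ρ - 1 := sub_pos.2 hρ
  have hC0 : 0 ≤ C := (abs_nonneg _).trans (hC 0 (by norm_num))
  refine ⟨C + (2 / (ρ - 1) + 2 * C / (ρ - 1)), by positivity, fun n x hx => ?_⟩
  cases n with
  | zero =>
    exact (hC x hx).trans (le_add_of_nonneg_right (by positivity))
  | succ n =>
    obtain ⟨P, hP⟩ := hext n
    have hr := hle n
    have hq := hpos n
    have hβ : ρ ≤ 1 / qs n := hr.trans (by gcongr; exact hc1 n)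
    refine (hP.abs_nonlin_le hδ ?_ (by linarith) (hrep 0).1 (hrep (n + 1)).1
      (fun y hy => NegSchwDiffeo.mapsTo_of_unimodal ht (hU _) (hrep (n + 1)).2 hy) hC hx).trans
      (le_add_of_nonneg_left hC0)
    rw [neg_div]
    linarith
end

section
/- Let J be a compact interval of positive length |J|, let C > 0, and let g be a C^2 diffeomorphism defined on J with nowhere vanishing derivative such that the nonlinearity satisfies |(N(g))(x)| = |g''(x)/(g'(x))^2| ≤ C/|J| for all x ∈ J. Then for all x, y ∈ J, |g'(x)/g'(y)| ≤ exp(C·|g(x)-g(y)|/|J|). In particular, if the image g(J) has length at most |J|, then the distortion satisfies |g'(x)/g'(y)| ≤ exp(C) for all x, y ∈ J. -/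
open Set MeasureTheory

/-- A nonzero `deriv g` agrees with the one-sided derivative at the endpoints of `[a, b]`, so if
`g` is `C²` on `[a, b]` then `deriv g` is `C¹` there. -/
lemma contDiffOn_deriv_of_deriv_ne_zero {a b : ℝ} {g : ℝ → ℝ} (hab : a < b)
    (hg : ContDiffOn ℝ 2 g (Icc a b)) (hg' : ∀ x ∈ Icc a b, deriv g x ≠ 0) :
    ContDiffOn ℝ 1 (deriv g) (Icc a b) :=
  (hg.derivWithin (uniqueDiffOn_Icc hab) (by norm_num)).congr fun x hx =>
    ((differentiableAt_of_deriv_ne_zero (hg' x hx)).derivWithin (uniqueDiffOn_Icc hab x hx)).symm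

/-- Cauchy's mean value theorem for `log |g'|` and `g`: the change of `log |g'|` is the change of
`g` times the nonlinearity at an intermediate point. -/
lemma exists_log_deriv_sub_eq_nonlin_mul {x y : ℝ} {g : ℝ → ℝ} (hxy : x < y)
    (hg : ContDiffOn ℝ 2 g (Icc x y)) (hg' : ∀ z ∈ Icc x y, deriv g z ≠ 0) :
    ∃ c ∈ Ioo x y,
      Real.log (deriv g y) - Real.log (deriv g x) = Nonlin g c * (g y - g x) := by
  have hd := contDiffOn_deriv_of_deriv_ne_zero hxy hg hg'
  obtain ⟨c, hc, h⟩ := exists_ratio_hasDerivAt_eq_ratio_slope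
    (fun z => Real.log (deriv g z)) (fun z => deriv (deriv g) z / deriv g z) hxy
    (hd.continuousOn.log hg')
    (fun z hz => (((hd.differentiableOn one_ne_zero).differentiableAt
      (Icc_mem_nhds hz.1 hz.2)).hasDerivAt).log (hg' z (Ioo_subset_Icc_self hz)))
    g (deriv g) hg.continuousOn
    (fun z hz => (differentiableAt_of_deriv_ne_zero
      (hg' z (Ioo_subset_Icc_self hz))).hasDerivAt)
  have hne := hg' c (Ioo_subset_Icc_self hc)
  refine ⟨c, hc, mul_right_cancel₀ hne ?_⟩
  rw [← h, Nonlin]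
  field_simp

lemma abs_log_deriv_sub_le_of_abs_nonlin_le {a b K : ℝ} {g : ℝ → ℝ}
    (hg : ContDiffOn ℝ 2 g (Icc a b)) (hg' : ∀ z ∈ Icc a b, deriv g z ≠ 0)
    (hN : ∀ z ∈ Icc a b, |Nonlin g z| ≤ K) {x y : ℝ} (hx : x ∈ Icc a b) (hy : y ∈ Icc a b) :
    |Real.log (deriv g x) - Real.log (deriv g y)| ≤ K * |g x - g y| := by
  wlog hxy : x ≤ y generalizing x y
  · rw [abs_sub_comm, abs_sub_comm (g x)]
    exact this hy hx (le_of_not_ge hxy)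
  obtain rfl | hlt := hxy.eq_or_lt
  · simp
  have hsub : Icc x y ⊆ Icc a b := Icc_subset_Icc hx.1 hy.2
  obtain ⟨c, hc, h⟩ := exists_log_deriv_sub_eq_nonlin_mul hlt (hg.mono hsub)
    fun z hz => hg' z (hsub hz)
  rw [abs_sub_comm, h, abs_mul, abs_sub_comm (g x)]
  exact mul_le_mul_of_nonneg_right (hN c (hsub (Ioo_subset_Icc_self hc))) (abs_nonneg _)

lemma abs_sub_le_len_image_Icc {a b : ℝ} {g : ℝ → ℝ} (hg : ContinuousOn g (Icc a b))
    {x y : ℝ} (hx : x ∈ Icc a b) (hy : y ∈ Icc a b) :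
    |g x - g y| ≤ len (g '' Icc a b) := by
  have hsub : uIcc y x ⊆ Icc a b := ordConnected_Icc.uIcc_subset hy hx
  have himage : uIcc (g y) (g x) ⊆ g '' Icc a b :=
    (intermediate_value_uIcc (hg.mono hsub)).trans (image_mono hsub)
  have h := ENNReal.toReal_mono (isCompact_Icc.image_of_continuousOn hg).measure_lt_top.ne
    (measure_mono (μ := volume) himage)
  rwa [Real.volume_interval, ENNReal.toReal_ofReal (abs_nonneg _)] at h

/-- Bounded nonlinearity implies bounded distortion: if `g` is a `C²`
diffeomorphism of `J = [a,b]` with `|N(g)| ≤ C / |J|` on `J`, then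
`|g'(x)/g'(y)| ≤ exp (C |g x - g y| / |J|)` for `x, y ∈ J`; in particular if
`|g(J)| ≤ |J|` then the distortion is at most `exp C`. -/
theorem distortion_from_nonlinearity_bound (a b C : ℝ) (g : ℝ → ℝ)
    (hab : a < b) (hC : 0 < C)
    (hg : ContDiffOn ℝ 2 g (Icc a b))
    (hg' : ∀ x ∈ Icc a b, deriv g x ≠ 0)
    (hinj : InjOn g (Icc a b))
    (hN : ∀ x ∈ Icc a b, |Nonlin g x| ≤ C / (b - a)) :
    (∀ x ∈ Icc a b, ∀ y ∈ Icc a b,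
      |deriv g x / deriv g y| ≤ Real.exp (C * |g x - g y| / (b - a))) ∧
    (len (g '' Icc a b) ≤ b - a →
      ∀ x ∈ Icc a b, ∀ y ∈ Icc a b,
        |deriv g x / deriv g y| ≤ Real.exp C) := by
  have hdist : ∀ x ∈ Icc a b, ∀ y ∈ Icc a b,
      |deriv g x / deriv g y| ≤ Real.exp (C * |g x - g y| / (b - a)) := by
    intro x hx y hy
    have hne := div_ne_zero (hg' x hx) (hg' y hy)
    rw [← Real.log_le_iff_le_exp (abs_pos.2 hne), Real.log_abs,
      Real.log_div (hg' x hx) (hg' y hy), mul_div_right_comm]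
    exact (le_abs_self _).trans (abs_log_deriv_sub_le_of_abs_nonlin_le hg hg' hN hx hy)
  refine ⟨hdist, fun hlen x hx y hy => (hdist x hx y hy).trans (Real.exp_le_exp.2 ?_)⟩
  rw [div_le_iff₀ (sub_pos.2 hab)]
  exact mul_le_mul_of_nonneg_left
    ((abs_sub_le_len_image_Icc hg.continuousOn hx hy).trans hlen) hC.le
end

section
/- Let f be a Feigenbaum map in the class U with induced Markov map F and partition intervals J_i indexed by i ∈ Z ∪ {-0}. If i and i' are indices such that J_{i'} ⊆ F(J_i), then |i'| ≥ |i|. Consequently, every admissible sequence w = i_0 i_1 ⋯ i_{k-1} satisfies |i_0| ≤ |i_1| ≤ ⋯ ≤ |i_{k-1}|. -/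
open Set MeasureTheory

/-- `g' = σ / ψ²` on `s`, and `ψ` is twice differentiable on `s` with derivatives `ψ₁`, `ψ₂`.
The Schwarzian derivative of `g` is then `-2 ψ₂ / ψ`. -/
structure SchwarzData (g : ℝ → ℝ) (s : Set ℝ) (σ : ℝ) (ψ ψ₁ ψ₂ : ℝ → ℝ) : Prop where
  sign : σ = 1 ∨ σ = -1
  pos : ∀ x ∈ s, 0 < ψ x
  deriv : ∀ x ∈ s, HasDerivAt g (σ / ψ x ^ 2) x
  deriv₁ : ∀ x ∈ s, HasDerivAt ψ (ψ₁ x) x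
  deriv₂ : ∀ x ∈ s, HasDerivAt ψ₁ (ψ₂ x) x

/-- `g` is a local diffeomorphism with negative Schwarzian derivative on `s`. -/
def NegSchwOn (g : ℝ → ℝ) (s : Set ℝ) : Prop :=
  ∃ σ ψ ψ₁ ψ₂, SchwarzData g s σ ψ ψ₁ ψ₂ ∧ ∀ x ∈ s, 0 < ψ₂ x

namespace SchwarzData

variable {f g : ℝ → ℝ} {s t : Set ℝ} {σ τ : ℝ} {φ φ₁ φ₂ ψ ψ₁ ψ₂ : ℝ → ℝ}

theorem comp (hf : SchwarzData f t τ φ φ₁ φ₂) (hg : SchwarzData g s σ ψ ψ₁ ψ₂)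
    (hst : MapsTo g s t) :
    SchwarzData (f ∘ g) s (τ * σ) (fun x => φ (g x) * ψ x)
      (fun x => φ₁ (g x) * σ / ψ x + φ (g x) * ψ₁ x)
      (fun x => φ₂ (g x) / ψ x ^ 3 + φ (g x) * ψ₂ x) where
  sign := by rcases hf.sign with h | h <;> rcases hg.sign with h' | h' <;> simp [h, h']
  pos x hx := mul_pos (hf.pos _ (hst hx)) (hg.pos x hx)
  deriv x hx := by
    refine ((hf.deriv _ (hst hx)).comp x (hg.deriv x hx)).congr_deriv ?_
    rw [mul_pow, div_mul_div_comm]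
  deriv₁ x hx := by
    have hψ := (hg.pos x hx).ne'
    refine (((hf.deriv₁ _ (hst hx)).comp x (hg.deriv x hx)).mul
      (hg.deriv₁ x hx)).congr_deriv ?_
    simp only [Function.comp]
    field_simp
  deriv₂ x hx := by
    have hψ := (hg.pos x hx).ne'
    have hσ : σ * σ = 1 := by rcases hg.sign with h | h <;> simp [h]
    refine (((((hf.deriv₂ _ (hst hx)).comp x (hg.deriv x hx)).mul_const σ).div
      (hg.deriv₁ x hx) hψ).add
      (((hf.deriv₁ _ (hst hx)).comp x (hg.deriv x hx)).mul (hg.deriv₂ x hx))).congr_deriv ?_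
    simp only [Function.comp]
    field_simp
    linear_combination φ₂ (g x) * hσ

theorem strictConvexOn (h : SchwarzData g s σ ψ ψ₁ ψ₂) (hs : Convex ℝ s) (ho : IsOpen s)
    (h₂ : ∀ x ∈ s, 0 < ψ₂ x) : StrictConvexOn ℝ s ψ := by
  refine StrictMonoOn.strictConvexOn_of_deriv hs
    (fun x hx => (h.deriv₁ x hx).continuousAt.continuousWithinAt) ?_
  rw [ho.interior_eq]
  have hmono : StrictMonoOn ψ₁ s := by
    refine strictMonoOn_of_deriv_pos hs
      (fun x hx => (h.deriv₂ x hx).continuousAt.continuousWithinAt) fun x hx => ?_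
    rw [ho.interior_eq] at hx
    rw [(h.deriv₂ x hx).deriv]
    exact h₂ x hx
  exact hmono.congr fun x hx => (h.deriv₁ x hx).deriv.symm

theorem exists_eq_one (h : SchwarzData g s σ ψ ψ₁ ψ₂) {a b : ℝ} (hab : a < b)
    (hs : Ioo a b ⊆ s) (hc : ContinuousOn g (Icc a b)) (ha : g a = a) (hb : g b = b) :
    ∃ u ∈ Ioo a b, ψ u = 1 ∧ σ = 1 := by
  obtain ⟨u, hu, hd⟩ := exists_hasDerivAt_eq_slope g (fun x => σ / ψ x ^ 2) hab hc
    fun x hx => h.deriv x (hs hx)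
  refine ⟨u, hu, ?_⟩
  have hψ := h.pos u (hs hu)
  rw [ha, hb, div_self (sub_ne_zero.2 hab.ne'), div_eq_one_iff_eq (by positivity)] at hd
  rcases h.sign with h1 | h1
  · exact ⟨by nlinarith, h1⟩
  · nlinarith

end SchwarzData

theorem StrictConvexOn.false_of_eq_one {s : Set ℝ} {ψ : ℝ → ℝ} (h : StrictConvexOn ℝ s ψ)
    {u v w : ℝ} (hu : u ∈ s) (hw : w ∈ s) (huv : u < v) (hvw : v < w)
    (h1 : ψ w = 1) (hv : ψ v = 1) (hle : ψ u ≤ 1) : False := by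
  have := h.slope_strict_mono_adjacent hu hw huv hvw
  rw [h1, hv, sub_self, zero_div, div_lt_iff₀ (sub_pos.2 huv)] at this
  linarith

namespace NegSchwOn

variable {f g : ℝ → ℝ} {s t : Set ℝ}

theorem comp (hf : NegSchwOn f t) (hg : NegSchwOn g s) (hst : MapsTo g s t) :
    NegSchwOn (f ∘ g) s := by
  obtain ⟨τ, φ, φ₁, φ₂, hf, hφ⟩ := hf
  obtain ⟨σ, ψ, ψ₁, ψ₂, hg, hψ⟩ := hg
  refine ⟨_, _, _, _, hf.comp hg hst, fun x hx => ?_⟩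
  have h1 := hf.pos _ (hst hx)
  have h2 := hg.pos x hx
  have h3 := hφ _ (hst hx)
  have h4 := hψ x hx
  positivity

theorem congr (hf : NegSchwOn f s) (hs : IsOpen s) (h : EqOn g f s) : NegSchwOn g s := by
  obtain ⟨τ, φ, φ₁, φ₂, hf, hφ⟩ := hf
  refine ⟨τ, φ, φ₁, φ₂, ⟨hf.sign, hf.pos, fun x hx => ?_, hf.deriv₁, hf.deriv₂⟩, hφ⟩
  exact (hf.deriv x hx).congr_of_eventuallyEq (h.eventuallyEq_of_mem (hs.mem_nhds hx))

theorem rescale {q : ℝ} (hq : 0 < q) (hf : NegSchwOn f (Ioo 0 q)) :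
    NegSchwOn (fun x => -(f (q * x)) / q) (Ioo 0 1) := by
  obtain ⟨τ, φ, φ₁, φ₂, hf, hφ⟩ := hf
  have hm : ∀ x ∈ Ioo (0 : ℝ) 1, q * x ∈ Ioo 0 q := fun x hx =>
    ⟨mul_pos hq hx.1, by nlinarith [hx.2]⟩
  have hl : ∀ x : ℝ, HasDerivAt (fun y => q * y) q x := fun x => by
    simpa using (hasDerivAt_id x).const_mul q
  refine ⟨-τ, fun x => φ (q * x), fun x => φ₁ (q * x) * q, fun x => φ₂ (q * x) * q * q,
    ⟨?_, fun x hx => hf.pos _ (hm x hx), fun x hx => ?_,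
      fun x hx => (hf.deriv₁ _ (hm x hx)).comp x (hl x),
      fun x hx => ((hf.deriv₂ _ (hm x hx)).comp x (hl x)).mul_const q⟩,
    fun x hx => by have := hφ _ (hm x hx); positivity⟩
  · rcases hf.sign with h | h <;> simp [h]
  · refine ((((hf.deriv _ (hm x hx)).comp x (hl x)).neg).div_const q).congr_deriv ?_
    have := (hf.pos _ (hm x hx)).ne'
    field_simp

/-- A map with negative Schwarzian derivative has at most three fixed points. -/
theorem false_of_four_fixed {l r a b c d : ℝ} (h : NegSchwOn g (Ioo l r))
    (hla : l < a) (hab : a < b) (hbc : b < c) (hcd : c < d) (hdr : d ≤ r)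
    (hcont : ContinuousOn g (Icc l r))
    (ha : g a = a) (hb : g b = b) (hc : g c = c) (hd : g d = d) : False := by
  obtain ⟨σ, ψ, ψ₁, ψ₂, h, h₂⟩ := h
  have hconv := h.strictConvexOn (convex_Ioo l r) isOpen_Ioo h₂
  obtain ⟨u, hu, hu1, -⟩ := h.exists_eq_one hab (Ioo_subset_Ioo (by linarith) (by linarith))
    (hcont.mono (Icc_subset_Icc (by linarith) (by linarith))) ha hb
  obtain ⟨v, hv, hv1, -⟩ := h.exists_eq_one hbc (Ioo_subset_Ioo (by linarith) (by linarith))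
    (hcont.mono (Icc_subset_Icc (by linarith) (by linarith))) hb hc
  obtain ⟨w, hw, hw1, -⟩ := h.exists_eq_one hcd (Ioo_subset_Ioo (by linarith) (by linarith))
    (hcont.mono (Icc_subset_Icc (by linarith) (by linarith))) hc hd
  exact hconv.false_of_eq_one ⟨by linarith [hu.1], by linarith [hu.2]⟩
    ⟨by linarith [hw.1], by linarith [hw.2]⟩ (hu.2.trans hv.1) (hv.2.trans hw.1) hw1 hv1 hu1.le

/-- If `g l < l` and `g` has negative Schwarzian derivative, then `g` cannot have
three fixed points to the right of `l`. -/
theorem false_of_three_fixed {l b c d : ℝ} (h : NegSchwOn g (Ioo l d))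
    (hlb : l < b) (hbc : b < c) (hcd : c < d) (hcont : ContinuousOn g (Icc l d))
    (hl : g l < l) (hb : g b = b) (hc : g c = c) (hd : g d = d) : False := by
  have hNS := h
  obtain ⟨σ, ψ, ψ₁, ψ₂, h, h₂⟩ := h
  have hconv := h.strictConvexOn (convex_Ioo l d) isOpen_Ioo h₂
  obtain ⟨v, hv, hv1, hσ⟩ := h.exists_eq_one hbc (Ioo_subset_Ioo (by linarith) (by linarith))
    (hcont.mono (Icc_subset_Icc (by linarith) (by linarith))) hb hc
  obtain ⟨w, hw, hw1, -⟩ := h.exists_eq_one hcd (Ioo_subset_Ioo (by linarith) (by linarith))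
    (hcont.mono (Icc_subset_Icc (by linarith) (by linarith))) hc hd
  have hbm : b ∈ Ioo l d := ⟨hlb, hbc.trans hcd⟩
  have hψ : 1 < ψ b := by
    by_contra! hle
    exact hconv.false_of_eq_one hbm ⟨by linarith [hw.1], hw.2⟩ hv.1 (hv.2.trans hw.1) hw1 hv1 hle
  have hder : HasDerivAt (fun x => g x - x) (σ / ψ b ^ 2 - 1) b :=
    (h.deriv b hbm).sub (hasDerivAt_id b)
  have hneg : σ / ψ b ^ 2 - 1 < 0 := by
    rw [hσ, sub_neg, div_lt_one (by positivity)]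
    nlinarith
  have hev : ∀ᶠ x in nhdsWithin b (Iio b), slope (fun x => g x - x) b x < 0 :=
    ((hasDerivAt_iff_tendsto_slope.1 hder).mono_left
      (nhdsWithin_mono b fun x hx => ne_of_lt hx)).eventually_lt_const hneg
  obtain ⟨x, hx, hxm⟩ := (hev.and (Ioo_mem_nhdsLT hlb)).exists
  rw [slope_def_field, hb, sub_self, sub_zero, div_neg_iff] at hx
  have hxg : x < g x := by
    rcases hx with hx | hx
    · linarith [hx.1]
    · linarith [hx.2, hxm.2]
  have hci : ContinuousOn (fun y => g y - y) (Icc l x) :=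
    (hcont.mono (Icc_subset_Icc_right (by linarith [hxm.2]))).sub continuousOn_id
  obtain ⟨a, ha, hga⟩ := intermediate_value_Ioo hxm.1.le hci
    (show (0 : ℝ) ∈ Ioo _ _ from ⟨sub_neg.2 hl, sub_pos.2 hxg⟩)
  exact hNS.false_of_four_fixed ha.1 (ha.2.trans hxm.2) hbc hcd le_rfl hcont
    (sub_eq_zero.1 hga) hb hc hd

end NegSchwOn

theorem NegSchwDiffeo.schwarzData {h : ℝ → ℝ} (hh : NegSchwDiffeo h) :
    ∃ ψ ψ₁ ψ₂, SchwarzData h (Ioo (-1) 0) 1 ψ ψ₁ ψ₂ ∧ ∀ x ∈ Ioo (-1 : ℝ) 0, 0 ≤ ψ₂ x := by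
  obtain ⟨hC, hpos, hS⟩ := hh
  have h0 : ContDiffOn ℝ 3 h (Ioo (-1) 0) := hC.mono Ioo_subset_Icc_self
  have h1 : ContDiffOn ℝ 2 (deriv h) (Ioo (-1) 0) := h0.deriv_of_isOpen isOpen_Ioo (by norm_num)
  have h2 : ContDiffOn ℝ 1 (deriv (deriv h)) (Ioo (-1) 0) :=
    h1.deriv_of_isOpen isOpen_Ioo (by norm_num)
  have key : ∀ {k : ℝ → ℝ} {n : WithTop ℕ∞}, n ≠ 0 → ContDiffOn ℝ n k (Ioo (-1) 0) →
      ∀ x ∈ Ioo (-1 : ℝ) 0, HasDerivAt k (deriv k x) x := fun hn hk x hx =>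
    ((hk.differentiableOn hn).differentiableAt (isOpen_Ioo.mem_nhds hx)).hasDerivAt
  have d0 := key (by norm_num) h0
  have d1 := key (by norm_num) h1
  have d2 := key (by norm_num) h2
  have hp : ∀ x ∈ Ioo (-1 : ℝ) 0, 0 < deriv h x := fun x hx => hpos x (Ioo_subset_Icc_self hx)
  refine ⟨fun x => deriv h x ^ (-1 / 2 : ℝ),
    fun x => (-1 / 2) * deriv (deriv h) x * deriv h x ^ (-3 / 2 : ℝ),
    fun x => (-1 / 2) * deriv (deriv (deriv h)) x * deriv h x ^ (-3 / 2 : ℝ) +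
      (3 / 4) * deriv (deriv h) x ^ 2 * deriv h x ^ (-5 / 2 : ℝ),
    ⟨Or.inl rfl, fun x hx => Real.rpow_pos_of_pos (hp x hx) _, fun x hx => ?_, fun x hx => ?_,
      fun x hx => ?_⟩, fun x hx => ?_⟩
  · refine (d0 x hx).congr_deriv ?_
    rw [← Real.rpow_natCast, ← Real.rpow_mul (hp x hx).le]
    norm_num [Real.rpow_neg_one]
  · refine ((d1 x hx).rpow_const (p := (-1 / 2 : ℝ)) (Or.inl (hp x hx).ne')).congr_deriv ?_
    rw [show (-1 / 2 - 1 : ℝ) = -3 / 2 by norm_num]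
    ring
  · refine (((d2 x hx).const_mul (-1 / 2 : ℝ)).mul
      ((d1 x hx).rpow_const (p := (-3 / 2 : ℝ)) (Or.inl (hp x hx).ne'))).congr_deriv ?_
    rw [show (-3 / 2 - 1 : ℝ) = -5 / 2 by norm_num]
    ring
  · have hS' := hS x (Ioo_subset_Icc_self hx)
    have hpx := hp x hx
    have e1 : deriv h x ^ (-3 / 2 : ℝ) = deriv h x * deriv h x ^ (-5 / 2 : ℝ) := by
      nth_rewrite 2 [← Real.rpow_one (deriv h x)]
      rw [← Real.rpow_add hpx]
      norm_num
    have hr := Real.rpow_pos_of_pos hpx (-5 / 2 : ℝ)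
    have e2 : deriv (deriv (deriv h)) x * deriv h x - 3 / 2 * deriv (deriv h) x ^ 2 ≤ 0 := by
      have : deriv (deriv (deriv h)) x * deriv h x - 3 / 2 * deriv (deriv h) x ^ 2 =
          Schw h x * deriv h x ^ 2 := by
        unfold Schw
        field_simp
      rw [this]
      exact mul_nonpos_of_nonpos_of_nonneg hS' (by positivity)
    beta_reduce
    rw [e1]
    nlinarith

theorem negSchwOn_Qmap {t : ℝ} (ht : 1 < t) : NegSchwOn (Qmap t) (Ioo 0 1) := by
  have ht0 : 0 < t := by linarith
  refine ⟨-1, fun x => t ^ (-1 / 2 : ℝ) * x ^ ((1 - t) / 2),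
    fun x => t ^ (-1 / 2 : ℝ) * ((1 - t) / 2 * x ^ ((1 - t) / 2 - 1)),
    fun x => t ^ (-1 / 2 : ℝ) *
      ((1 - t) / 2 * (((1 - t) / 2 - 1) * x ^ ((1 - t) / 2 - 1 - 1))),
    ⟨Or.inr rfl, fun x hx => ?_, fun x hx => ?_, fun x hx => ?_, fun x hx => ?_⟩, fun x hx => ?_⟩
  · have := hx.1
    positivity
  · have hd : HasDerivAt (fun y : ℝ => -(y ^ t)) (-(t * x ^ (t - 1))) x :=
      (Real.hasDerivAt_rpow_const (Or.inl hx.1.ne')).neg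
    have he : Qmap t =ᶠ[nhds x] fun y : ℝ => -(y ^ t) := by
      filter_upwards [Ioi_mem_nhds hx.1] with y hy
      rw [Qmap, abs_of_pos hy]
    refine (hd.congr_of_eventuallyEq he).congr_deriv ?_
    rw [mul_pow, ← Real.rpow_natCast, ← Real.rpow_natCast, ← Real.rpow_mul ht0.le,
      ← Real.rpow_mul hx.1.le]
    have e : (1 - t) / 2 * ((2 : ℕ) : ℝ) = -(t - 1) := by push_cast; ring
    rw [e, Real.rpow_neg hx.1.le]
    have := Real.rpow_pos_of_pos hx.1 (t - 1)
    norm_num [Real.rpow_neg_one]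
    field_simp
  · exact (Real.hasDerivAt_rpow_const (Or.inl hx.1.ne')).const_mul _
  · exact ((Real.hasDerivAt_rpow_const (Or.inl hx.1.ne')).const_mul _).const_mul _
  · refine mul_pos (Real.rpow_pos_of_pos ht0 _) ?_
    rw [← mul_assoc]
    exact mul_pos (mul_pos_of_neg_of_neg (by linarith) (by linarith))
      (Real.rpow_pos_of_pos hx.1 _)

theorem InU.negSchwOn {f : ℝ → ℝ} (hf : InU f) : NegSchwOn f (Ioo 0 1) := by
  obtain ⟨-, t, ht, h, hh, hfh⟩ := hf
  obtain ⟨φ, φ₁, φ₂, hφ, hφ₂⟩ := hh.schwarzData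
  obtain ⟨σ, ψ, ψ₁, ψ₂, hψ, hψ₂⟩ := negSchwOn_Qmap ht
  have hm : MapsTo (Qmap t) (Ioo 0 1) (Ioo (-1) 0) := fun x hx => by
    have h1 := Real.rpow_pos_of_pos hx.1 t
    have h2 := Real.rpow_lt_one hx.1.le hx.2 (by linarith : 0 < t)
    rw [Qmap, abs_of_pos hx.1]
    constructor <;> linarith
  have hc : NegSchwOn (h ∘ Qmap t) (Ioo 0 1) := by
    refine ⟨_, _, _, _, hφ.comp hψ hm, fun x hx => ?_⟩
    have h1 := hφ.pos _ (hm hx)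
    have h2 := hψ.pos x hx
    have h3 := hφ₂ _ (hm hx)
    have h4 := hψ₂ x hx
    positivity
  exact hc.congr isOpen_Ioo fun x hx => hfh x ⟨by linarith [hx.1], hx.2.le⟩

namespace Unimodal

variable {g : ℝ → ℝ}

theorem apply_le_apply_zero (hg : Unimodal g) {x : ℝ} (hx : x ∈ Icc (-1 : ℝ) 1) : g x ≤ g 0 := by
  obtain ⟨-, hm, ha, -⟩ := hg
  rcases le_total x 0 with h | h
  · exact hm.monotoneOn ⟨hx.1, h⟩ ⟨by norm_num, le_rfl⟩ h
  · exact ha.antitoneOn ⟨le_rfl, by norm_num⟩ ⟨h, hx.2⟩ h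

theorem continuousOn_iterate_two (hg : Unimodal g) : ContinuousOn (g^[2]) (Icc (-1) 1) :=
  hg.1.comp hg.1 hg.2.2.2.2.2.2

theorem eq_of_fixed (hg : Unimodal g) {x y : ℝ} (hx : x ∈ Icc (0 : ℝ) 1) (hy : y ∈ Icc (0 : ℝ) 1)
    (hgx : g x = x) (hgy : g y = y) : x = y := by
  have ha := hg.2.2.1
  rcases lt_trichotomy x y with h | h | h
  · linarith [ha hx hy h]
  · exact h
  · linarith [ha hy hx h]

theorem fixed_of_iterate_two_fixed (hg : Unimodal g) (h0 : g 0 ≤ 0) {x : ℝ}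
    (hx : x ∈ Icc (-1 : ℝ) 0) (h : g^[2] x = x) : g x = x := by
  have hx1 : x ∈ Icc (-1 : ℝ) 1 := ⟨hx.1, hx.2.trans zero_le_one⟩
  have hgx : g x ∈ Icc (-1 : ℝ) 0 :=
    ⟨(hg.2.2.2.2.2.2 hx1).1, (hg.apply_le_apply_zero hx1).trans h0⟩
  have h' : g (g x) = x := h
  rcases lt_trichotomy (g x) x with hlt | heq | hlt
  · linarith [hg.2.1 hgx hx hlt]
  · exact heq
  · linarith [hg.2.1 hx hgx hlt]

theorem mapsTo_Ioo (hg : Unimodal g) {c : ℝ} (hc : c ∈ Icc (0 : ℝ) 1) :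
    MapsTo g (Ioo 0 c) (Ioo (g c) 1) := fun x hx => by
  have ha := hg.2.2.1
  have h0 : (0 : ℝ) ∈ Icc (0 : ℝ) 1 := ⟨le_rfl, zero_le_one⟩
  have hx' : x ∈ Icc (0 : ℝ) 1 := ⟨hx.1.le, hx.2.le.trans hc.2⟩
  exact ⟨ha hx' hc hx.2, (ha h0 hx' hx.1).trans_le (hg.2.2.2.2.2.2 ⟨by norm_num, h0.2⟩).2⟩

theorem negSchwOn_iterate_two (hg : Unimodal g) (hN : NegSchwOn g (Ioo 0 1)) {c : ℝ}
    (hc : c ∈ Icc (0 : ℝ) 1) (hgc : 0 ≤ g c) : NegSchwOn (g^[2]) (Ioo 0 c) := by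
  obtain ⟨σ, ψ, ψ₁, ψ₂, h, h₂⟩ := hN
  have hsub : Ioo 0 c ⊆ Ioo (0 : ℝ) 1 := Ioo_subset_Ioo_right hc.2
  have hN' : NegSchwOn g (Ioo 0 c) := ⟨σ, ψ, ψ₁, ψ₂, ⟨h.sign, fun x hx => h.pos x (hsub hx),
    fun x hx => h.deriv x (hsub hx), fun x hx => h.deriv₁ x (hsub hx),
    fun x hx => h.deriv₂ x (hsub hx)⟩, fun x hx => h₂ x (hsub hx)⟩
  exact NegSchwOn.comp ⟨σ, ψ, ψ₁, ψ₂, h, h₂⟩ hN'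
    ((hg.mapsTo_Ioo hc).mono_right (Ioo_subset_Ioo_left hgc))

theorem pos_of_renorm (hg : Unimodal g) (h0 : 0 < g 0) {q : ℝ} (hq0 : 0 < |q|) (hq1 : |q| < 1)
    (hR : Unimodal (Renorm2 g q)) : 0 < q ∧ 0 ≤ g q := by
  have hc := hg.1
  have hq : 0 < q := by
    by_contra! hle
    have hq : q < 0 := lt_of_le_of_ne hle (abs_pos.1 hq0)
    rw [abs_of_neg hq] at hq1
    have hc0 : ContinuousAt g 0 := hc.continuousAt (Icc_mem_nhds (by norm_num) (by norm_num))
    obtain ⟨y, hy, hym⟩ := (((hc0.eventually (lt_mem_nhds h0)).filter_mono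
      nhdsWithin_le_nhds).and (Ioo_mem_nhdsGT (neg_pos.2 hq))).exists
    have hy1 : y ∈ Icc (0 : ℝ) 1 := ⟨hym.1.le, by linarith [hym.2]⟩
    have h01 : (0 : ℝ) ∈ Icc (0 : ℝ) 1 := ⟨le_rfl, zero_le_one⟩
    have hlt := hg.2.2.1 h01 hy1 hym.1
    have hlt2 := hg.2.2.1 ⟨hy.le, (hg.2.2.2.2.2.2 ⟨by linarith [hy1.1], hy1.2⟩).2⟩
      ⟨h0.le, (hg.2.2.2.2.2.2 ⟨by norm_num, h01.2⟩).2⟩ hlt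
    have hz : y / -q ∈ Icc (0 : ℝ) 1 :=
      ⟨div_nonneg hym.1.le (by linarith), (div_le_one (by linarith)).2 hym.2.le⟩
    have hR' := hR.2.2.1 h01 hz (div_pos hym.1 (by linarith))
    have e : -q * (y / -q) = y := mul_div_cancel₀ y (neg_ne_zero.2 hq.ne)
    simp only [Renorm2, e, mul_zero] at hR'
    rw [div_lt_div_right_of_neg hq] at hR'
    change -g (g 0) < -g (g y) at hR'
    linarith
  refine ⟨hq, ?_⟩
  rw [abs_of_pos hq] at hq1
  by_contra! hneg
  obtain ⟨z, hz, hgz⟩ := intermediate_value_Ioo' hq.le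
    (hc.mono (Icc_subset_Icc (by norm_num) hq1.le)) (show (0 : ℝ) ∈ Ioo _ _ from ⟨hneg, h0⟩)
  have hz' : -(z / q) ∈ Icc (-1 : ℝ) 0 :=
    ⟨neg_le_neg ((div_le_one hq).2 hz.2.le), neg_nonpos.2 (div_nonneg hz.1.le hq.le)⟩
  have hR' := hR.2.1 ⟨le_rfl, by norm_num⟩ hz' (neg_lt_neg ((div_lt_one hq).2 hz.2))
  have e : -q * -(z / q) = z := by field_simp
  have e' : -q * -1 = q := by ring
  simp only [Renorm2, e, e'] at hR'
  rw [div_lt_div_iff_of_pos_right hq] at hR'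
  change -g (g q) < -g (g z) at hR'
  rw [hgz] at hR'
  linarith [hg.apply_le_apply_zero (hg.2.2.2.2.2.2 (x := q) ⟨by linarith, hq1.le⟩)]

theorem false_of_iterate_two_fixed (hg : Unimodal g) (hN : NegSchwOn g (Ioo 0 1))
    (h0 : g^[2] 0 < 0) {p b : ℝ} (hp : p ≤ 1) (hgp : g p = p) (hb : 0 < b) (hbp : b < p)
    (hgb : g^[2] b = b) : False := by
  have hb1 : b ∈ Icc (0 : ℝ) 1 := ⟨hb.le, hbp.le.trans hp⟩
  have hpc := hg.2.2.1 hb1 ⟨hb.le.trans hbp.le, hp⟩ hbp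
  rw [hgp] at hpc
  have hgc : g (g b) = b := hgb
  have hc : g b ≤ 1 := (hg.2.2.2.2.2.2 ⟨by linarith, hb1.2⟩).2
  refine (hg.negSchwOn_iterate_two hN (c := g b) ⟨by linarith, hc⟩
    (by rw [hgc]; exact hb.le)).false_of_three_fixed hb hbp hpc
    (hg.continuousOn_iterate_two.mono (Icc_subset_Icc (by norm_num) hc)) h0 hgb ?_ ?_
  · change g (g p) = p
    rw [hgp, hgp]
  · change g (g (g b)) = g b
    rw [hgc]

theorem fixed_of_renorm (hg : Unimodal g) (hN : NegSchwOn g (Ioo 0 1))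
    (h0 : g^[2] 0 < 0) {q : ℝ} (hq0 : 0 < q) (hq1 : q ≤ 1) (hgq : 0 ≤ g q)
    (hfix : g^[2] q = q) : g q = q := by
  have hfix' : g (g q) = q := hfix
  have hr : 0 < g q := by
    refine lt_of_le_of_ne hgq fun h => ?_
    rw [← h] at hfix'
    change g (g 0) < 0 at h0
    rw [hfix'] at h0
    linarith
  have hr1 : g q ≤ 1 := (hg.2.2.2.2.2.2 ⟨by linarith, hq1⟩).2
  have key : ∀ b, 0 < b → b ≤ 1 → b < g b → g b ≤ 1 → g (g b) = b → False := by
    intro b hb hb1 hlt hgb1 hgb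
    have hci : ContinuousOn (fun x => g x - x) (Icc b (g b)) :=
      (hg.1.mono (Icc_subset_Icc (by linarith) hgb1)).sub continuousOn_id
    obtain ⟨p, hp, hgp⟩ := intermediate_value_Ioo' hlt.le hci
      (show (0 : ℝ) ∈ Ioo _ _ from ⟨by simp only [hgb]; linarith, sub_pos.2 hlt⟩)
    exact hg.false_of_iterate_two_fixed hN h0 (hp.2.le.trans hgb1) (sub_eq_zero.1 hgp) hb hp.1 hgb
  rcases lt_trichotomy (g q) q with h | h | h
  · exact (key (g q) hr hr1 (by rwa [hfix']) (by rwa [hfix']) (by rw [hfix'])).elim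
  · exact h
  · exact (key q hq0 hq1 h hr1 hfix').elim

theorem negSchwOn_renorm (hg : Unimodal g) (hN : NegSchwOn g (Ioo 0 1)) {q : ℝ}
    (hq0 : 0 < q) (hq1 : q ≤ 1) (hgq : 0 ≤ g q) : NegSchwOn (Renorm2 g q) (Ioo 0 1) := by
  refine ((hg.negSchwOn_iterate_two hN ⟨hq0.le, hq1⟩ hgq).rescale hq0).congr isOpen_Ioo
    fun x hx => ?_
  have hqx : q * x ∈ Icc (-1 : ℝ) 1 := by
    have := mul_pos hq0 hx.1
    constructor <;> nlinarith [hx.2]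
  simp only [Renorm2, neg_mul]
  change -g (g (-(q * x))) / q = -g (g (q * x)) / q
  rw [hg.2.2.2.1 _ hqx]

end Unimodal

theorem mul_renorm2 (g : ℝ → ℝ) {q : ℝ} (hq : q ≠ 0) (x : ℝ) :
    -q * Renorm2 g q x = g^[2] (-q * x) := by
  rw [Renorm2]
  field_simp

namespace FeigSeq

variable {f : ℝ → ℝ} {fs : ℕ → ℝ → ℝ} {qs : ℕ → ℝ}

theorem iterate_two_fixed (h : FeigSeq f fs qs) {k : ℕ} {x : ℝ} (hx : fs (k + 1) x = x) :
    (fs k)^[2] (-qs k * x) = -qs k * x := by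
  obtain ⟨-, hq, -, -, -, hR⟩ := h.2 k
  rw [← mul_renorm2 _ (abs_pos.1 hq), ← hR, hx]

theorem neg_of_nonpos (h : FeigSeq f fs qs) {k : ℕ} (h0 : fs k 0 ≤ 0) :
    qs k < 0 ∧ fs k (qs k) = qs k ∧ fs (k + 1) 0 ≤ 0 := by
  obtain ⟨hU, hq0, hq1, hfix, -, hR⟩ := h.2 k
  have hq1' := abs_le.1 hq1.le
  have hle : qs k ≤ 0 := by
    have h1 := hU.apply_le_apply_zero (hU.2.2.2.2.2.2 hq1')
    change fs k (fs k (qs k)) = qs k at hfix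
    linarith
  have hq : qs k < 0 := lt_of_le_of_ne hle (abs_pos.1 hq0)
  refine ⟨hq, hU.fixed_of_iterate_two_fixed h0 ⟨hq1'.1, hle⟩ hfix, ?_⟩
  have h2 : (fs k)^[2] 0 ≤ 0 :=
    (hU.apply_le_apply_zero (hU.2.2.2.2.2.2 ⟨by norm_num, by norm_num⟩)).trans h0
  rw [hR, Renorm2, mul_zero]
  exact div_nonpos_of_nonneg_of_nonpos (by linarith) hle

theorem fixed_of_fixed (h : FeigSeq f fs qs) {k : ℕ} (h0 : fs k 0 ≤ 0) {x : ℝ}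
    (hx : x ∈ Icc (-1 : ℝ) 0) (hfx : fs (k + 1) x = x) : fs k (-qs k * x) = -qs k * x := by
  obtain ⟨hq, -, -⟩ := h.neg_of_nonpos h0
  obtain ⟨hU, -, hq1, -⟩ := h.2 k
  rw [abs_of_neg hq] at hq1
  exact hU.fixed_of_iterate_two_fixed h0
    ⟨by nlinarith [hx.1, hx.2], by nlinarith [hx.1, hx.2]⟩ (h.iterate_two_fixed hfx)

theorem neg_one_lt (h : FeigSeq f fs qs) {k : ℕ} : -1 < qs k := by
  obtain ⟨-, -, hq1, -⟩ := h.2 k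
  exact (abs_lt.1 hq1).1

theorem apply_zero_pos_succ (h : FeigSeq f fs qs) {k : ℕ} (h0 : 0 < fs k 0)
    (hN : NegSchwOn (fs k) (Ioo 0 1)) : 0 < fs (k + 1) 0 := by
  by_contra! hle
  obtain ⟨hU, hq0, hq1, hfix, -, hR⟩ := h.2 k
  obtain ⟨hq, hgq⟩ := hU.pos_of_renorm h0 hq0 hq1 (hR ▸ (h.2 (k + 1)).1)
  obtain ⟨hn1, hf1, hz1⟩ := h.neg_of_nonpos hle
  obtain ⟨hn2, hf2, hz2⟩ := h.neg_of_nonpos hz1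
  obtain ⟨hn3, hf3, -⟩ := h.neg_of_nonpos hz2
  have l1 := h.neg_one_lt (k := k + 1)
  have l2 := h.neg_one_lt (k := k + 1 + 1)
  have l3 := h.neg_one_lt (k := k + 1 + 1 + 1)
  have hx2 := h.fixed_of_fixed hle ⟨l2.le, hn2.le⟩ hf2
  have hy3 := h.fixed_of_fixed hz1 ⟨l3.le, hn3.le⟩ hf3
  have hx3 := h.fixed_of_fixed hle ⟨by nlinarith, by nlinarith⟩ hy3
  generalize hx2e : -qs (k + 1) * qs (k + 1 + 1) = x₂ at hx2
  generalize hy3e : -qs (k + 1 + 1) * qs (k + 1 + 1 + 1) = y₃ at hx3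
  generalize hx3e : -qs (k + 1) * y₃ = x₃ at hx3
  have hy3l : qs (k + 1 + 1) < y₃ := by nlinarith
  have hy3n : y₃ < 0 := by nlinarith
  have h12 : qs (k + 1) < x₂ := by nlinarith
  have h23 : x₂ < x₃ := by nlinarith
  have h3 : x₃ < 0 := by nlinarith
  rw [abs_of_pos hq] at hq1
  exact (hU.negSchwOn_iterate_two hN ⟨hq.le, hq1.le⟩ hgq).false_of_four_fixed
    (a := -qs k * x₃) (b := -qs k * x₂) (c := -qs k * qs (k + 1)) (d := qs k)
    (by nlinarith) (by nlinarith) (by nlinarith) (by nlinarith) le_rfl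
    (hU.continuousOn_iterate_two.mono (Icc_subset_Icc (by norm_num) hq1.le))
    (h.iterate_two_fixed hx3) (h.iterate_two_fixed hx2) (h.iterate_two_fixed hf1) hfix

theorem iterate_two_zero_neg (h : FeigSeq f fs qs) {k : ℕ} (h0 : 0 < fs k 0)
    (hN : NegSchwOn (fs k) (Ioo 0 1)) : (fs k)^[2] 0 < 0 := by
  have h1 := h.apply_zero_pos_succ h0 hN
  obtain ⟨hU, hq0, hq1, hfix, -, hR⟩ := h.2 k
  obtain ⟨hq, -⟩ := hU.pos_of_renorm h0 hq0 hq1 (hR ▸ (h.2 (k + 1)).1)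
  have h2 := mul_renorm2 (fs k) hq.ne' 0
  rw [← hR, mul_zero] at h2
  rw [← h2]
  nlinarith

theorem renorm_pos_negSchwOn (h : FeigSeq f fs qs) (h0 : 0 < f 0) (hN : NegSchwOn f (Ioo 0 1)) :
    ∀ k, 0 < fs k 0 ∧ NegSchwOn (fs k) (Ioo 0 1)
  | 0 => by rw [h.1]; exact ⟨h0, hN⟩
  | k + 1 => by
    obtain ⟨ih0, ihN⟩ := h.renorm_pos_negSchwOn h0 hN k
    obtain ⟨hU, hq0, hq1, -, -, hR⟩ := h.2 k
    obtain ⟨hq, hgq⟩ := hU.pos_of_renorm ih0 hq0 hq1 (hR ▸ (h.2 (k + 1)).1)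
    refine ⟨h.apply_zero_pos_succ ih0 ihN, ?_⟩
    rw [hR]
    exact hU.negSchwOn_renorm ihN hq ((le_abs_self _).trans hq1.le) hgq

/-- The endpoint of each restrictive interval is the fixed point in the decreasing branch. -/
theorem pos_and_fixed (h : FeigSeq f fs qs) (h0 : 0 < f 0) (hN : NegSchwOn f (Ioo 0 1)) (k : ℕ) :
    0 < qs k ∧ qs k < 1 ∧ fs k (qs k) = qs k := by
  obtain ⟨hk0, hkN⟩ := h.renorm_pos_negSchwOn h0 hN k
  obtain ⟨hU, hq0, hq1, hfix, -, hR⟩ := h.2 k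
  obtain ⟨hq, hgq⟩ := hU.pos_of_renorm hk0 hq0 hq1 (hR ▸ (h.2 (k + 1)).1)
  rw [abs_of_pos hq] at hq1
  exact ⟨hq, hq1, hU.fixed_of_renorm hkN (h.iterate_two_zero_neg hk0 hkN) hq hq1.le hgq hfix⟩

theorem not_fixed_of_neg (h : FeigSeq f fs qs) (h0 : 0 < f 0) (hN : NegSchwOn f (Ioo 0 1))
    {k : ℕ} {x : ℝ} (hx : x ∈ Ioo (-1 : ℝ) 0) : fs (k + 1) x ≠ x := fun hfx => by
  obtain ⟨hk0, hkN⟩ := h.renorm_pos_negSchwOn h0 hN k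
  obtain ⟨hq, hq1, hfix⟩ := h.pos_and_fixed h0 hN k
  exact (h.2 k).1.false_of_iterate_two_fixed hkN (h.iterate_two_zero_neg hk0 hkN) hq1.le hfix
    (by nlinarith [hx.1, hx.2]) (by nlinarith [hx.1, hx.2]) (h.iterate_two_fixed hfx)

theorem semiconj (h : FeigSeq f fs qs) :
    ∀ k, Function.Semiconj (fun x => (∏ j ∈ Finset.range k, -qs j) * x) (fs k) (f^[2 ^ k])
  | 0 => fun x => by simp [h.1]
  | k + 1 => fun x => by
    obtain ⟨-, hq, -, -, -, hR⟩ := h.2 k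
    have ih := ((h.semiconj k).iterate_right 2).eq (-qs k * x)
    rw [← Function.iterate_mul, ← pow_succ] at ih
    simp only [Finset.prod_range_succ, mul_assoc, hR]
    rw [mul_renorm2 _ (abs_pos.1 hq)]
    exact ih

theorem scale_ne_zero (h : FeigSeq f fs qs) (k : ℕ) : ∏ j ∈ Finset.range k, -qs j ≠ 0 :=
  Finset.prod_ne_zero_iff.2 fun j _ => neg_ne_zero.2 (abs_pos.1 (h.2 j).2.1)

/-- The periodic points of a Feigenbaum map are the endpoints of its restrictive intervals. -/
theorem abs_feigPoints (h : FeigSeq f fs qs) (h0 : 0 < f 0) (hN : NegSchwOn f (Ioo 0 1))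
    {p : ℕ → ℝ} (hp : FeigPoints f p) : ∀ n, |p n| = |∏ j ∈ Finset.range n, -qs j|
  | 0 => by simp [hp.1]
  | 1 => by
    obtain ⟨hq, hq1, hfix⟩ := h.pos_and_fixed h0 hN 0
    obtain ⟨-, hp1, hfp, -⟩ := hp
    rw [← h.1] at hfp
    simp [(h.2 0).1.eq_of_fixed ⟨hp1.1.le, hp1.2.le⟩ ⟨hq.le, hq1.le⟩ hfp hfix]
  | n + 2 => by
    obtain ⟨hq, hq1, hfix⟩ := h.pos_and_fixed h0 hN (n + 1)
    obtain ⟨hpf, hp0, hpl⟩ := hp.2.2.2 (n + 2) (by omega)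
    have ih := h.abs_feigPoints h0 hN hp (n + 1)
    have ha := h.scale_ne_zero (n + 1)
    have hs := (h.semiconj (n + 1)).eq
    rw [Finset.prod_range_succ, abs_mul, abs_neg, abs_of_pos hq]
    simp only [show n + 2 - 1 = n + 1 from rfl] at hpf hpl
    rw [ih] at hpl
    generalize ∏ j ∈ Finset.range (n + 1), -qs j = a at ha hs hpl
    have hx1 : |p (n + 2) / a| < 1 := by
      rw [abs_div]
      exact (div_lt_one (abs_pos.2 ha)).2 hpl
    have hx0 : p (n + 2) / a ≠ 0 := div_ne_zero (abs_pos.1 hp0) ha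
    have hax : a * (p (n + 2) / a) = p (n + 2) := mul_div_cancel₀ _ ha
    have hfx : fs (n + 1) (p (n + 2) / a) = p (n + 2) / a := by
      apply mul_left_cancel₀ ha
      rw [hs, hax, hpf]
    obtain ⟨hl, hr⟩ := abs_lt.1 hx1
    rcases lt_or_gt_of_ne hx0 with hneg | hpos
    · exact (h.not_fixed_of_neg h0 hN ⟨hl, hneg⟩ hfx).elim
    · rw [← (h.2 (n + 1)).1.eq_of_fixed ⟨hpos.le, hr.le⟩ ⟨hq.le, hq1.le⟩ hfx hfix,
        ← abs_of_pos hpos, ← abs_mul, hax]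

theorem mapsTo_iterate (h : FeigSeq f fs qs) (n : ℕ) :
    ∀ x, |x| ≤ |∏ j ∈ Finset.range n, -qs j| →
      |f^[2 ^ n] x| ≤ |∏ j ∈ Finset.range n, -qs j| := by
  intro x hx
  have ha := h.scale_ne_zero n
  have hs := (h.semiconj n).eq
  generalize ∏ j ∈ Finset.range n, -qs j = a at ha hs hx
  have hx1 : |x / a| ≤ 1 := by
    rw [abs_div]
    exact (div_le_one (abs_pos.2 ha)).2 hx
  have hy := abs_le.2 ((h.2 n).1.2.2.2.2.2.2 (abs_le.1 hx1))
  have := hs (x / a)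
  simp only [mul_div_cancel₀ _ ha] at this
  rw [← this, abs_mul]
  exact mul_le_of_le_one_right (abs_nonneg _) hy

end FeigSeq

theorem FeigPoints.strictAnti_abs {f : ℝ → ℝ} {p : ℕ → ℝ} (hp : FeigPoints f p) :
    StrictAnti fun n => |p n| := by
  refine strictAnti_nat_of_succ_lt fun n => ?_
  obtain ⟨h0, h1, -, h2⟩ := hp
  rcases n with _ | n
  · simpa [h0, abs_of_pos h1.1] using h1.2
  · exact (h2 (n + 2) (by omega)).2.2

theorem abs_le_of_mem_Jint {p : ℕ → ℝ} (i : Bool × ℕ) {x : ℝ} (hx : x ∈ Jint p i) :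
    |x| ≤ |p i.2| := by
  have h1 := abs_nonneg (p (i.2 + 1))
  unfold Jint at hx
  split_ifs at hx
  · exact abs_le.2 ⟨by linarith [hx.1, hx.2], hx.2⟩
  · exact abs_le.2 ⟨hx.1, by linarith [hx.1, hx.2]⟩

theorem exists_mem_Jint_abs_eq {p : ℕ → ℝ} (hp : StrictAnti fun n => |p n|) (i : Bool × ℕ) :
    ∃ x ∈ Jint p i, |x| = |p i.2| := by
  have h := hp (Nat.lt_succ_self i.2)
  unfold Jint
  split_ifs
  · exact ⟨|p i.2|, ⟨h, le_rfl⟩, abs_abs _⟩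
  · exact ⟨-|p i.2|, ⟨le_rfl, neg_lt_neg h⟩, by rw [abs_neg, abs_abs]⟩

/-- If `J i' ⊆ F (J i)` then `|i'| ≥ |i|`; consequently, along every admissible
sequence `w = i₀ i₁ ⋯ i_(k-1)` the magnitudes satisfy
`|i₀| ≤ |i₁| ≤ ⋯ ≤ |i_(k-1)|`. -/
theorem admissible_magnitudes_monotone (f : ℝ → ℝ) (p : ℕ → ℝ)
    (hfU : InU f) (hf : Feigenbaum f) (hp : FeigPoints f p) :
    (∀ i i' : Bool × ℕ, Jint p i' ⊆ f^[2 ^ i.2] '' Jint p i → i.2 ≤ i'.2) ∧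
    (∀ w : List (Bool × ℕ), Admissible f p w →
      List.Chain' (fun i j : Bool × ℕ => i.2 ≤ j.2) w) := by
  have hanti := hp.strictAnti_abs
  have key : ∀ i i' : Bool × ℕ, Jint p i' ⊆ f^[2 ^ i.2] '' Jint p i → i.2 ≤ i'.2 := by
    intro i i' hsub
    obtain ⟨fs, qs, h⟩ := hf
    have h0 : 0 < f 0 := by
      have := hfU.1.apply_le_apply_zero (x := p 1) ⟨by linarith [hp.2.1.1], hp.2.1.2.le⟩
      rw [hp.2.2.1] at this
      exact hp.2.1.1.trans_le this
    obtain ⟨y, hy, hyp⟩ := exists_mem_Jint_abs_eq hanti i'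
    obtain ⟨x, hx, rfl⟩ := hsub hy
    have habs := h.abs_feigPoints h0 hfU.negSchwOn hp i.2
    have hle := h.mapsTo_iterate i.2 x (habs ▸ abs_le_of_mem_Jint i hx)
    rw [hyp, ← habs] at hle
    exact hanti.le_iff_ge.1 hle
  refine ⟨key, fun w => ?_⟩
  induction w with
  | nil => exact fun _ => List.isChain_nil
  | cons i w ih =>
    cases w with
    | nil => exact fun _ => List.isChain_singleton i
    | cons j w => exact fun hw => List.isChain_cons_cons.2 ⟨key i j hw.1, ih hw.2⟩
end
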